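/- arXiv:0910.0641 — 3 statements merged into one kernel-verified Lean document; each statement's English description precedes it below -/
import Mathlib

section
/- There exists a constant ε₁ > 0 such that for all integers d ≥ 0, n ≥ d+1, t ≥ 1, and every f : F₂ⁿ → F₂, δ_d(f^{⊕t}) ≥ (1 − (1 − 2·min{ε₁/4, 2^{d−2} · δ_d(f)})^{t/2^d}) / 2. In particular, if δ_d(f) ≥ 0.1 then δ_d(f^{⊕t}) ≥ 1/2 − 2^{−Ω(t/2^d)}. -/
open scoped Classical

noncomputable section

/-- `f : 𝔽₂ⁿ → 𝔽₂` has degree at most `d` (as a multilinear polynomial). -/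
def degLE (n d : ℕ) (f : (Fin n → ZMod 2) → ZMod 2) : Prop :=
  ∃ p : MvPolynomial (Fin n) (ZMod 2), p.totalDegree ≤ d ∧ ∀ x, MvPolynomial.eval x p = f x

/-- fractional Hamming distance between two functions on 𝔽₂ⁿ. -/
def hdist (n : ℕ) (f g : (Fin n → ZMod 2) → ZMod 2) : ℝ :=
  ((Finset.univ.filter fun x => f x ≠ g x).card : ℝ) / 2 ^ n

/-- distance of `f` to the Reed–Muller code RM(d,n). -/
def deltaD (n d : ℕ) (f : (Fin n → ZMod 2) → ZMod 2) : ℝ :=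
  sInf {r : ℝ | ∃ g, degLE n d g ∧ r = hdist n f g}

/-- Rejection probability of the `k`-flat test: a uniformly random `k`-flat is chosen
(via a uniformly random injective affine parametrization `u ↦ M u + b`), and the test
rejects iff the restriction of `f` does not have degree at most `d`. -/
def Rej (n d k : ℕ) (f : (Fin n → ZMod 2) → ZMod 2) : ℝ :=
  ((Finset.univ.filter fun Mb : Matrix (Fin n) (Fin k) (ZMod 2) × (Fin n → ZMod 2) =>
      Function.Injective Mb.1.mulVec ∧
        ¬ degLE k d (fun u => f (Mb.1.mulVec u + Mb.2))).card : ℝ) /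
  ((Finset.univ.filter fun Mb : Matrix (Fin n) (Fin k) (ZMod 2) × (Fin n → ZMod 2) =>
      Function.Injective Mb.1.mulVec).card : ℝ)

/-- Rejection probability of the (d+1)-fold derivative (Gowers norm) test. -/
def Rej0 (n d : ℕ) (f : (Fin n → ZMod 2) → ZMod 2) : ℝ :=
  ((Finset.univ.filter fun xa : (Fin n → ZMod 2) × (Fin (d+1) → Fin n → ZMod 2) =>
      (∑ S : Finset (Fin (d+1)), f (xa.1 + ∑ i ∈ S, xa.2 i)) = 1).card : ℝ) /
  ((2 ^ n) * (2 ^ n) ^ (d+1) : ℝ)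

/-- the (d+1)-st Gowers norm of `f`. -/
def gowersNorm (n d : ℕ) (f : (Fin n → ZMod 2) → ZMod 2) : ℝ :=
  (1 - 2 * Rej0 n d f) ^ ((1 : ℝ) / 2 ^ (d+1))

/-- t-fold XOR of `f`, as a function on 𝔽₂^(t·n). -/
def xorPow (n t : ℕ) (f : (Fin n → ZMod 2) → ZMod 2) :
    (Fin (t * n) → ZMod 2) → ZMod 2 :=
  fun x => ∑ i : Fin t, f fun j => x (finProdFinEquiv (i, j))

/-- elementary symmetric polynomial of degree m on n variables over 𝔽₂. -/
def symPoly (n m : ℕ) : (Fin n → ZMod 2) → ZMod 2 :=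
  fun x => ∑ I ∈ Finset.powersetCard m Finset.univ, ∏ i ∈ I, x i

/-- the hyperplane `{x : L·x = b}`. -/
def hyp (n : ℕ) (L : Fin n → ZMod 2) (b : ZMod 2) : Set (Fin n → ZMod 2) :=
  {x | ∑ i, L i * x i = b}


section Derivatives

variable {V W : Type} [AddCommGroup V] [AddCommGroup W]

/-- The discrete derivative of `f` in direction `h`. -/
def deriv₂ (h : V) (f : V → ZMod 2) : V → ZMod 2 := fun x => f (x + h) + f x

/-- All `k`-fold discrete derivatives of `f` vanish, i.e. `f` has degree less than `k`. -/
def DegLT : ℕ → (V → ZMod 2) → Prop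
  | 0, f => f = 0
  | k + 1, f => ∀ h, DegLT k (deriv₂ h f)

lemma deriv₂_zero (h : V) : deriv₂ h (0 : V → ZMod 2) = 0 := by
  funext x; simp [deriv₂]

lemma deriv₂_add (h : V) (f g : V → ZMod 2) : deriv₂ h (f + g) = deriv₂ h f + deriv₂ h g := by
  funext x; simp only [deriv₂, Pi.add_apply]; ring

lemma deriv₂_comm (h h' : V) (f : V → ZMod 2) :
    deriv₂ h (deriv₂ h' f) = deriv₂ h' (deriv₂ h f) := by
  funext x; simp only [deriv₂, add_right_comm x h h']; ring

lemma deriv₂_self [Module (ZMod 2) V] (h : V) (f : V → ZMod 2) : deriv₂ h (deriv₂ h f) = 0 := by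
  funext x
  simp only [deriv₂, add_assoc, ZModModule.add_self, add_zero, Pi.zero_apply]
  generalize f (x + h) = a
  generalize f x = b
  revert a b; decide

lemma deriv₂_add_dir (h h' : V) (f : V → ZMod 2) :
    deriv₂ (h + h') f = deriv₂ h f + deriv₂ h' f + deriv₂ h' (deriv₂ h f) := by
  funext x
  simp only [deriv₂, Pi.add_apply, ← add_assoc, add_right_comm x h' h]
  generalize f (x + h + h') = a
  generalize f (x + h) = b
  generalize f (x + h') = c
  generalize f x = d
  revert a b c d; decide

lemma deriv₂_mul (h : V) (f g : V → ZMod 2) :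
    deriv₂ h (f * g) = deriv₂ h f * g + f * deriv₂ h g + deriv₂ h f * deriv₂ h g := by
  funext x
  simp only [deriv₂, Pi.add_apply, Pi.mul_apply]
  generalize f (x + h) = a
  generalize f x = b
  generalize g (x + h) = c
  generalize g x = d
  revert a b c d; decide

lemma deriv₂_comp {A B : V → W} (hA : ∀ x h, A (x + h) = A x + B h) (h : V) (f : W → ZMod 2) :
    deriv₂ h (f ∘ A) = deriv₂ (B h) f ∘ A := by
  funext x; simp [deriv₂, hA]

namespace DegLT

lemma zero (k : ℕ) : DegLT k (0 : V → ZMod 2) := by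
  induction k with
  | zero => rfl
  | succ k ih => intro h; rw [deriv₂_zero]; exact ih

lemma add {k : ℕ} {f g : V → ZMod 2} (hf : DegLT k f) (hg : DegLT k g) : DegLT k (f + g) := by
  induction k generalizing f g with
  | zero => simp only [DegLT] at *; simp [hf, hg]
  | succ k ih => intro h; rw [deriv₂_add]; exact ih (hf h) (hg h)

lemma succ {k : ℕ} {f : V → ZMod 2} (hf : DegLT k f) : DegLT (k + 1) f := by
  induction k generalizing f with
  | zero => simp only [DegLT] at hf; rw [hf]; exact zero _
  | succ k ih => intro h; exact ih (hf h)

lemma mono {k l : ℕ} (hkl : k ≤ l) {f : V → ZMod 2} (hf : DegLT k f) : DegLT l f := by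
  induction hkl with
  | refl => exact hf
  | step _ ih => exact ih.succ

lemma deriv {k : ℕ} {f : V → ZMod 2} (hf : DegLT k f) (h : V) : DegLT k (deriv₂ h f) := by
  cases k with
  | zero => simp only [DegLT] at *; rw [hf, deriv₂_zero]
  | succ k => exact (hf h).succ

lemma comp {A B : V → W} (hA : ∀ x h, A (x + h) = A x + B h) {k : ℕ} {f : W → ZMod 2}
    (hf : DegLT k f) : DegLT k (f ∘ A) := by
  induction k generalizing f with
  | zero => simp only [DegLT] at *; simp [hf]
  | succ k ih => intro h; rw [deriv₂_comp hA]; exact ih (hf _)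

lemma const (c : ZMod 2) : DegLT 1 (fun _ : V => c) := by
  intro h
  funext x
  exact CharTwo.add_self_eq_zero c

lemma eq_const {f : V → ZMod 2} (hf : DegLT 1 f) (x y : V) : f x = f y := by
  have := congrFun (hf (x - y)) y
  simp only [deriv₂, add_sub_cancel, Pi.zero_apply] at this
  exact CharTwo.add_eq_zero.1 this

lemma affine {a b : V → ZMod 2} (ha : ∀ x h, a (x + h) = a x + b h) : DegLT 2 a := by
  intro h
  have : deriv₂ h a = fun _ => b h := by
    funext x
    simp only [deriv₂, ha]
    generalize a x = u
    generalize b h = v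
    revert u v; decide
  rw [this]
  exact const _

lemma mul {k l : ℕ} {f g : V → ZMod 2} (hf : DegLT (k + 1) f) (hg : DegLT (l + 1) g) :
    DegLT (k + l + 1) (f * g) := by
  induction hn : k + l generalizing k l f g with
  | zero =>
    obtain ⟨rfl, rfl⟩ : k = 0 ∧ l = 0 := by omega
    intro h
    rw [deriv₂_mul]
    have h₁ := hf h
    have h₂ := hg h
    simp only [DegLT] at h₁ h₂ ⊢
    simp [h₁, h₂]
  | succ n ih =>
    intro h
    rw [deriv₂_mul]
    have h₁ : DegLT (n + 1) (deriv₂ h f * g) := by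
      cases k with
      | zero => rw [show deriv₂ h f = 0 from hf h, zero_mul]; exact zero _
      | succ k => exact ih (hf h) hg (by omega)
    have h₂ : DegLT (n + 1) (f * deriv₂ h g) := by
      cases l with
      | zero => rw [show deriv₂ h g = 0 from hg h, mul_zero]; exact zero _
      | succ l => exact ih hf (hg h) (by omega)
    have h₃ : DegLT (n + 1) (deriv₂ h f * deriv₂ h g) := by
      cases l with
      | zero => rw [show deriv₂ h g = 0 from hg h, mul_zero]; exact zero _
      | succ l => exact ih (hf.deriv h) (hg h) (by omega)
    exact (h₁.add h₂).add h₃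

lemma sum {ι : Type} (s : Finset ι) {k : ℕ} {f : ι → V → ZMod 2} (hf : ∀ i ∈ s, DegLT k (f i)) :
    DegLT k (∑ i ∈ s, f i) := by
  induction s using Finset.induction_on with
  | empty => simpa using zero k
  | insert i s hi ih =>
    rw [Finset.sum_insert hi]
    exact (hf i (Finset.mem_insert_self _ _)).add
      (ih fun j hj => hf j (Finset.mem_insert_of_mem hj))

lemma prod {ι : Type} (s : Finset ι) {f : ι → V → ZMod 2} (hf : ∀ i ∈ s, DegLT 2 (f i)) :
    DegLT (s.card + 1) (∏ i ∈ s, f i) := by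
  induction s using Finset.induction_on with
  | empty => exact const (1 : ZMod 2)
  | insert i s hi ih =>
    rw [Finset.prod_insert hi, Finset.card_insert_of_notMem hi, add_comm s.card 1]
    exact (hf i (Finset.mem_insert_self _ _)).mul
      (ih fun j hj => hf j (Finset.mem_insert_of_mem hj))

end DegLT

instance dualFintype [Module (ZMod 2) V] [Fintype V] : Fintype (Module.Dual (ZMod 2) V) :=
  have : Finite (Module.Dual (ZMod 2) V) := DFunLike.finite _
  Fintype.ofFinite _

/-- Every function on a finite `𝔽₂`-vector space has finite degree. -/
lemma exists_degLT [Module (ZMod 2) V] [Fintype V] (f : V → ZMod 2) : ∃ k, DegLT k f := by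
  refine ⟨_, (?_ : DegLT (Fintype.card (Module.Dual (ZMod 2) V) + 1) f)⟩
  have key : f = ∑ y ∈ Finset.univ.filter (fun y => f y ≠ 0),
      ∏ a : Module.Dual (ZMod 2) V, fun x => a x + (a y + 1) := by
    have hδ : ∀ x y : V, (∏ a : Module.Dual (ZMod 2) V, (a x + (a y + 1))) =
        if x = y then 1 else 0 := by
      intro x y
      split_ifs with hxy
      · subst hxy
        refine Finset.prod_eq_one fun a _ => ?_
        generalize a x = u
        revert u; decide
      · have hne : x - y ≠ 0 := sub_ne_zero.2 hxy
        obtain ⟨a, ha⟩ : ∃ a : Module.Dual (ZMod 2) V, a (x - y) ≠ 0 := by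
          by_contra! h
          exact hne ((Module.forall_dual_apply_eq_zero_iff (ZMod 2) _).1 h)
        refine Finset.prod_eq_zero (Finset.mem_univ a) ?_
        rw [map_sub] at ha
        revert ha
        generalize a x = u
        generalize a y = v
        revert u v; decide
    funext x
    simp only [Finset.sum_apply, Finset.prod_apply, hδ, Finset.sum_ite_eq, Finset.mem_filter,
      Finset.mem_univ, true_and]
    split_ifs with h
    · revert h
      generalize f x = u
      revert u; decide
    · simpa using h
  rw [key]
  refine DegLT.sum _ fun y _ => ?_
  refine DegLT.prod Finset.univ fun a _ => DegLT.affine (b := a) fun x h => ?_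
  rw [map_add]; ring

end Derivatives

section Averages

open scoped BigOperators

variable {V : Type} [Fintype V]

/-- The embedding of `𝔽₂` into `{0, 1} ⊆ ℝ`. -/
def ind (a : ZMod 2) : ℝ := if a = 0 then 0 else 1

/-- The character `a ↦ (-1)ᵃ` of `𝔽₂`. -/
def sgn (a : ZMod 2) : ℝ := if a = 0 then 1 else -1

lemma ZMod2.cases (a : ZMod 2) : a = 0 ∨ a = 1 := by revert a; decide

lemma ind_zero : ind 0 = 0 := by simp [ind]

lemma ind_one : ind 1 = 1 := by simp [ind]

lemma sgn_zero : sgn 0 = 1 := by simp [sgn]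

lemma sgn_one : sgn 1 = -1 := by simp [sgn]

lemma one_add_one₂ : (1 : ZMod 2) + 1 = 0 := by decide

lemma ind_nonneg (a : ZMod 2) : 0 ≤ ind a := by
  rcases ZMod2.cases a with rfl | rfl <;> simp [ind_zero, ind_one]

lemma ind_le_one (a : ZMod 2) : ind a ≤ 1 := by
  rcases ZMod2.cases a with rfl | rfl <;> simp [ind_zero, ind_one]

lemma ind_add (a b : ZMod 2) : ind (a + b) = ind a + ind b - 2 * (ind a * ind b) := by
  rcases ZMod2.cases a with rfl | rfl <;> rcases ZMod2.cases b with rfl | rfl <;>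
    simp only [one_add_one₂, add_zero, zero_add, ind_zero, ind_one] <;> norm_num

lemma ind_mul (a b : ZMod 2) : ind (a * b) = ind a * ind b := by
  rcases ZMod2.cases a with rfl | rfl <;> rcases ZMod2.cases b with rfl | rfl <;>
    norm_num [ind_zero, ind_one]

lemma ind_add_le (a b : ZMod 2) : ind (a + b) ≤ ind a + ind b := by
  rw [ind_add]
  nlinarith [mul_nonneg (ind_nonneg a) (ind_nonneg b)]

lemma sgn_eq (a : ZMod 2) : sgn a = 1 - 2 * ind a := by
  rcases ZMod2.cases a with rfl | rfl <;> norm_num [ind_zero, ind_one, sgn_zero, sgn_one]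

lemma sgn_add (a b : ZMod 2) : sgn (a + b) = sgn a * sgn b := by
  rcases ZMod2.cases a with rfl | rfl <;> rcases ZMod2.cases b with rfl | rfl <;>
    simp only [one_add_one₂, add_zero, zero_add, sgn_zero, sgn_one] <;> norm_num

lemma sgn_sum {ι : Type} (s : Finset ι) (a : ι → ZMod 2) :
    sgn (∑ i ∈ s, a i) = ∏ i ∈ s, sgn (a i) := by
  induction s using Finset.induction_on with
  | empty => simp [sgn_zero]
  | insert i s hi ih => rw [Finset.sum_insert hi, Finset.prod_insert hi, sgn_add, ih]

lemma sq_expect_le [Nonempty V] (g : V → ℝ) : (𝔼 x, g x) ^ 2 ≤ 𝔼 x, g x ^ 2 := by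
  have h := Finset.expect_mul_sq_le_sq_mul_sq Finset.univ g (fun _ => 1)
  simpa using h

lemma expect_pi_prod {ι : Type} [Fintype ι] [DecidableEq ι] (g : ι → V → ℝ) :
    𝔼 x : ι → V, ∏ i, g i (x i) = ∏ i, 𝔼 y, g i y := by
  simp only [Fintype.expect_eq_sum_div_card, Finset.prod_div_distrib, Finset.prod_univ_sum,
    Fintype.piFinset_univ, Finset.prod_const, Finset.card_univ, Fintype.card_pi, Nat.cast_pow]

/-- The fraction of points at which `f` is nonzero. -/
def dens (f : V → ZMod 2) : ℝ := 𝔼 x, ind (f x)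

lemma dens_nonneg (f : V → ZMod 2) : 0 ≤ dens f := Finset.expect_nonneg fun _ _ => ind_nonneg _

variable [AddCommGroup V]

lemma expect_add_right (g : V → ℝ) (h : V) : 𝔼 x, g (x + h) = 𝔼 x, g x :=
  Fintype.expect_equiv (Equiv.addRight h) _ _ fun _ => rfl

lemma expect_add_left (g : V → ℝ) (h : V) : 𝔼 x, g (h + x) = 𝔼 x, g x :=
  Fintype.expect_equiv (Equiv.addLeft h) _ _ fun _ => rfl

/-- The probability that a random `k`-fold derivative of `f` is nonzero at a random point. -/
def rej : ℕ → (V → ZMod 2) → ℝ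
  | 0, f => dens f
  | k + 1, f => 𝔼 h, rej k (deriv₂ h f)

/-- The `2 ^ k`-th power of the `k`-th Gowers uniformity norm of `(-1)^f`. -/
def gowersPow : ℕ → (V → ZMod 2) → ℝ
  | 0, f => 𝔼 x, sgn (f x)
  | k + 1, f => 𝔼 h, gowersPow k (deriv₂ h f)

lemma rej_nonneg (k : ℕ) (f : V → ZMod 2) : 0 ≤ rej k f := by
  induction k generalizing f with
  | zero => exact dens_nonneg f
  | succ k ih => exact Finset.expect_nonneg fun h _ => ih _

lemma rej_add_degLT {k : ℕ} (f : V → ZMod 2) {p : V → ZMod 2} (hp : DegLT k p) :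
    rej k (f + p) = rej k f := by
  induction k generalizing f p with
  | zero => simp only [DegLT] at hp; simp [hp]
  | succ k ih =>
    simp only [rej, deriv₂_add]
    exact Finset.expect_congr rfl fun h _ => ih _ (hp h)

lemma dens_deriv₂_le (f : V → ZMod 2) (h : V) : dens (deriv₂ h f) ≤ 2 * dens f := by
  calc dens (deriv₂ h f) ≤ 𝔼 x, (ind (f (x + h)) + ind (f x)) :=
        Finset.expect_le_expect fun x _ => ind_add_le _ _
    _ = 2 * dens f := by
        rw [Finset.expect_add_distrib, expect_add_right (fun x => ind (f x))]
        simp only [dens]; ring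

lemma expect_dens_deriv₂ (f : V → ZMod 2) :
    𝔼 h, dens (deriv₂ h f) = 2 * dens f * (1 - dens f) := by
  have hinner : ∀ x, 𝔼 h, ind (deriv₂ h f x) =
      dens f + ind (f x) - 2 * dens f * ind (f x) := by
    intro x
    simp only [deriv₂, ind_add, Finset.expect_sub_distrib, Finset.expect_add_distrib,
      ← Finset.mul_expect, ← Finset.expect_mul, Finset.expect_const Finset.univ_nonempty]
    rw [expect_add_left (fun x => ind (f x))]
    simp only [dens]; ring
  simp only [dens]
  rw [Finset.expect_comm]
  simp only [hinner, Finset.expect_sub_distrib, Finset.expect_add_distrib, ← Finset.mul_expect,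
    Finset.expect_const Finset.univ_nonempty]
  simp only [dens]; ring

lemma rej_succ_le (k : ℕ) (f : V → ZMod 2) : rej (k + 1) f ≤ 2 * rej k f := by
  induction k generalizing f with
  | zero =>
    simp only [rej, expect_dens_deriv₂]
    nlinarith [sq_nonneg (dens f)]
  | succ k ih =>
    rw [rej, rej, Finset.mul_expect]
    exact Finset.expect_le_expect fun h _ => ih _

/-- A function of small support `μ` is rejected with probability about `2 ^ k * μ`. -/
lemma le_rej_of_dens (k : ℕ) (f : V → ZMod 2) :
    2 ^ k * dens f * (1 - (2 ^ k - 1) * dens f) ≤ rej k f := by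
  induction k generalizing f with
  | zero => simp [rej]
  | succ k ih =>
    have hk : (1 : ℝ) ≤ 2 ^ k := one_le_pow₀ (by norm_num)
    have h₁ : 𝔼 h, (2 ^ k * (1 - (2 ^ k - 1) * (2 * dens f))) * dens (deriv₂ h f) ≤
        rej (k + 1) f := by
      refine Finset.expect_le_expect fun h _ => le_trans ?_ (ih _)
      have h₂ := dens_deriv₂_le f h
      have h₃ := dens_nonneg (deriv₂ h f)
      have : 0 ≤ 2 ^ k * (2 ^ k - 1) * dens (deriv₂ h f) * (2 * dens f - dens (deriv₂ h f)) :=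
        mul_nonneg (mul_nonneg (mul_nonneg (by positivity) (by linarith)) h₃) (by linarith)
      nlinarith
    rw [← Finset.mul_expect, expect_dens_deriv₂] at h₁
    refine le_trans ?_ h₁
    have : 0 ≤ 2 ^ k * (2 ^ k - 1) * dens f * dens f ^ 2 :=
      mul_nonneg (mul_nonneg (mul_nonneg (by positivity) (by linarith)) (dens_nonneg f))
        (sq_nonneg _)
    rw [pow_succ]
    nlinarith

lemma gowersPow_eq (k : ℕ) (f : V → ZMod 2) : gowersPow k f = 1 - 2 * rej k f := by
  induction k generalizing f with
  | zero =>
    simp only [gowersPow, rej, dens, sgn_eq, Finset.expect_sub_distrib, ← Finset.mul_expect,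
      Finset.expect_const Finset.univ_nonempty]
  | succ k ih =>
    simp only [gowersPow, rej, ih, Finset.expect_sub_distrib, ← Finset.mul_expect,
      Finset.expect_const Finset.univ_nonempty]

lemma sq_gowersPow_le (k : ℕ) (f : V → ZMod 2) : gowersPow k f ^ 2 ≤ gowersPow (k + 1) f := by
  induction k generalizing f with
  | zero =>
    simp only [gowersPow, deriv₂, sgn_add]
    rw [Finset.expect_comm]
    simp only [← Finset.expect_mul]
    have : ∀ x, 𝔼 h, sgn (f (x + h)) = 𝔼 y, sgn (f y) :=
      fun x => expect_add_left (fun y => sgn (f y)) x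
    simp only [this, ← Finset.mul_expect, sq, le_refl]
  | succ k ih =>
    exact (sq_expect_le _).trans (Finset.expect_le_expect fun h _ => ih _)

lemma gowersPow_zero_pow_le (k : ℕ) (f : V → ZMod 2) :
    gowersPow 0 f ^ 2 ^ (k + 1) ≤ gowersPow (k + 1) f := by
  induction k with
  | zero => simpa using sq_gowersPow_le 0 f
  | succ k ih =>
    calc gowersPow 0 f ^ 2 ^ (k + 2) = (gowersPow 0 f ^ 2 ^ (k + 1)) ^ 2 := by
          rw [← pow_mul, ← pow_succ]
      _ ≤ gowersPow (k + 1) f ^ 2 :=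
          pow_le_pow_left₀ (Even.pow_nonneg ⟨2 ^ k, by ring⟩ _) ih 2
      _ ≤ _ := sq_gowersPow_le _ _

lemma gowersPow_add_degLT {k : ℕ} (f : V → ZMod 2) {p : V → ZMod 2} (hp : DegLT k p) :
    gowersPow k (f + p) = gowersPow k f := by
  rw [gowersPow_eq, gowersPow_eq, rej_add_degLT f hp]

lemma gowersPow_comp_equiv {W : Type} [AddCommGroup W] [Fintype W] (e : V ≃+ W) (k : ℕ)
    (f : W → ZMod 2) : gowersPow k (f ∘ e) = gowersPow k f := by
  induction k generalizing f with
  | zero => exact Fintype.expect_equiv e.toEquiv _ _ fun _ => rfl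
  | succ k ih =>
    refine Fintype.expect_equiv e.toEquiv _ _ fun h => ?_
    rw [deriv₂_comp (B := e) (fun x h => map_add e x h), ih]
    rfl

lemma gowersPow_pi {ι : Type} [Fintype ι] [DecidableEq ι] (k : ℕ) (f : ι → V → ZMod 2) :
    gowersPow k (fun x : ι → V => ∑ i, f i (x i)) = ∏ i, gowersPow k (f i) := by
  induction k generalizing f with
  | zero => simp only [gowersPow, sgn_sum]; exact expect_pi_prod fun i x => sgn (f i x)
  | succ k ih =>
    have : ∀ h : ι → V, deriv₂ h (fun x : ι → V => ∑ i, f i (x i)) =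
        fun x => ∑ i, deriv₂ (h i) (f i) (x i) := by
      intro h
      funext x
      simp only [deriv₂, Pi.add_apply, Finset.sum_add_distrib]
    simp only [gowersPow, this, ih]
    exact expect_pi_prod fun i h => gowersPow k (deriv₂ h (f i))

end Averages

section ExactDegree

open scoped BigOperators

variable {V : Type} [AddCommGroup V]

/-- If both `A` and its translate by `h₀` lie in `B` and are disjoint, then `A` is at most half
of `B`. -/
lemma two_mul_card_le {G : Type} [AddCommGroup G] {A B : Finset G} (h₀ : G)
    (hAB : A ⊆ B) (hB : ∀ h ∈ A, h + h₀ ∈ B) (hA : ∀ h ∈ A, h + h₀ ∉ A) :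
    2 * A.card ≤ B.card := by
  have hdisj : Disjoint A (A.map (addRightEmbedding h₀)) := by
    rw [Finset.disjoint_right]
    intro x hx
    obtain ⟨y, hy, rfl⟩ := Finset.mem_map.1 hx
    exact hA y hy
  have hsub : A ∪ A.map (addRightEmbedding h₀) ⊆ B := by
    refine Finset.union_subset hAB fun x hx => ?_
    obtain ⟨y, hy, rfl⟩ := Finset.mem_map.1 hx
    exact hB y hy
  have := Finset.card_le_card hsub
  rw [Finset.card_union_of_disjoint hdisj, Finset.card_map] at this
  omega

lemma DegLT.deriv₂_add_dir {k : ℕ} {f : V → ZMod 2} (hf : DegLT (k + 2) f) {h h' : V}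
    (h₁ : DegLT k (deriv₂ h f)) (h₂ : DegLT k (deriv₂ h' f)) : DegLT k (deriv₂ (h + h') f) := by
  rw [_root_.deriv₂_add_dir]
  exact (h₁.add h₂).add (hf h h')

lemma rej_le_two_pow_mul [Fintype V] (k j : ℕ) (f : V → ZMod 2) :
    rej (k + j) f ≤ 2 ^ j * rej k f := by
  induction j with
  | zero => simp
  | succ j ih =>
    have := rej_succ_le (k + j) f
    rw [pow_succ]
    change rej (k + j + 1) f ≤ _
    linarith

variable [Module (ZMod 2) V] [Fintype V]

/-- For `f` of exact degree `k + 1`, few derivatives of `f` have degree less than `k`. -/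
lemma card_degLT_deriv₂_le (k : ℕ) {f : V → ZMod 2} (hf : DegLT (k + 2) f)
    (hf' : ¬ DegLT (k + 1) f) :
    (Finset.univ.filter fun h => DegLT k (deriv₂ h f)).card * 2 ^ (k + 1) ≤ Fintype.card V := by
  induction k generalizing f with
  | zero =>
    obtain ⟨h₀, h_h₀⟩ := not_forall.1 hf'
    have := two_mul_card_le (A := Finset.univ.filter fun h => DegLT 0 (deriv₂ h f))
      (B := Finset.univ) h₀ (Finset.subset_univ _) (fun _ _ => Finset.mem_univ _) (by
        simp only [Finset.mem_filter, Finset.mem_univ, true_and]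
        intro h h₁ h₂
        have h₃ := hf.deriv₂_add_dir h₁ h₂
        rw [← add_assoc, ZModModule.add_self, zero_add] at h₃
        exact h_h₀ h₃)
    rw [Finset.card_univ] at this
    omega
  | succ k ih =>
    obtain ⟨h₀, h_h₀⟩ := not_forall.1 hf'
    have h₁ := ih (hf h₀) h_h₀
    have h₂ := two_mul_card_le (A := Finset.univ.filter fun h => DegLT (k + 1) (deriv₂ h f))
      (B := Finset.univ.filter fun h => DegLT k (deriv₂ h (deriv₂ h₀ f))) h₀ (by
        intro h
        simp only [Finset.mem_filter, Finset.mem_univ, true_and]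
        intro hh
        rw [deriv₂_comm]
        exact hh h₀) (by
        simp only [Finset.mem_filter, Finset.mem_univ, true_and]
        intro h hh
        refine (hf h₀).deriv₂_add_dir ?_ ?_
        · rw [deriv₂_comm]
          exact hh h₀
        · rw [deriv₂_self]
          exact DegLT.zero _) (by
        simp only [Finset.mem_filter, Finset.mem_univ, true_and]
        intro h h₁ h₂
        have h₃ := hf.deriv₂_add_dir h₁ h₂
        rw [← add_assoc, ZModModule.add_self, zero_add] at h₃
        exact h_h₀ h₃)
    calc _ = 2 * (Finset.univ.filter fun h => DegLT (k + 1) (deriv₂ h f)).card * 2 ^ (k + 1) := by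
          ring
      _ ≤ _ := (Nat.mul_le_mul_right _ h₂).trans h₁

lemma two_pow_le_card (k : ℕ) {f : V → ZMod 2} (hf : DegLT (k + 1) f) (hf' : ¬ DegLT k f) :
    2 ^ k ≤ Fintype.card V := by
  cases k with
  | zero => exact Fintype.card_pos
  | succ k =>
    have h := card_degLT_deriv₂_le k hf hf'
    have : 0 < (Finset.univ.filter fun h => DegLT k (deriv₂ h f)).card := by
      refine Finset.card_pos.2 ⟨0, ?_⟩
      simp only [Finset.mem_filter, Finset.mem_univ, true_and]
      have h₀ : deriv₂ 0 f = 0 := by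
        funext x
        simpa [deriv₂] using CharTwo.add_self_eq_zero (f x)
      rw [h₀]
      exact DegLT.zero _
    nlinarith

/-- The probability that a random square matrix over `𝔽₂` is nonsingular. -/
def nonsingProb (k : ℕ) : ℝ := ∏ j ∈ Finset.range k, (1 - (1 / 2) ^ (j + 1))

lemma nonsingProb_nonneg (k : ℕ) : 0 ≤ nonsingProb k :=
  Finset.prod_nonneg fun j _ => sub_nonneg.2 (pow_le_one₀ (by norm_num) (by norm_num))

lemma le_nonsingProb_succ (k : ℕ) : 1 / 4 + (1 / 2) ^ (k + 2) ≤ nonsingProb (k + 1) := by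
  induction k with
  | zero => norm_num [nonsingProb]
  | succ k ih =>
    have hrec : nonsingProb (k + 2) = nonsingProb (k + 1) * (1 - (1 / 2) ^ (k + 2)) :=
      Finset.prod_range_succ _ _
    have hx : ((1 : ℝ) / 2) ^ (k + 2) ≤ 1 / 4 := by
      calc ((1 : ℝ) / 2) ^ (k + 2) ≤ (1 / 2) ^ 2 :=
            pow_le_pow_of_le_one (by norm_num) (by norm_num) (by omega)
        _ = 1 / 4 := by norm_num
    have hx₀ : 0 < ((1 : ℝ) / 2) ^ (k + 2) := by positivity
    rw [hrec, show k + 1 + 2 = (k + 2) + 1 from rfl, pow_succ _ (k + 2)]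
    nlinarith

lemma quarter_le_nonsingProb (k : ℕ) : 1 / 4 ≤ nonsingProb k := by
  cases k with
  | zero => norm_num [nonsingProb]
  | succ k => exact le_trans (by simp) (le_nonsingProb_succ k)

/-- The `k`-fold derivative test rejects a function of exact degree `k` at least as often as a
random `k × k` matrix over `𝔽₂` is nonsingular. -/
lemma nonsingProb_le_rej (k : ℕ) {f : V → ZMod 2} (hf : DegLT (k + 1) f) (hf' : ¬ DegLT k f) :
    nonsingProb k ≤ rej k f := by
  induction k generalizing f with
  | zero =>
    obtain ⟨x, hx⟩ := Function.ne_iff.1 hf'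
    have : ∀ y, ind (f y) = 1 := fun y => by
      rw [hf.eq_const y x, (ZMod2.cases (f x)).resolve_left hx, ind_one]
    simp [nonsingProb, rej, dens, this]
  | succ k ih =>
    have hstep : ∀ h, nonsingProb k * (1 - if DegLT k (deriv₂ h f) then 1 else 0) ≤
        rej k (deriv₂ h f) := by
      intro h
      split_ifs with hh
      · simpa using rej_nonneg _ _
      · simpa using ih (hf h) hh
    have h₁ : 𝔼 h, nonsingProb k * (1 - if DegLT k (deriv₂ h f) then (1 : ℝ) else 0) ≤
        rej (k + 1) f := Finset.expect_le_expect fun h _ => hstep h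
    refine le_trans ?_ h₁
    rw [← Finset.mul_expect, Finset.expect_sub_distrib,
      Finset.expect_const Finset.univ_nonempty, nonsingProb, Finset.prod_range_succ,
      ← nonsingProb]
    refine mul_le_mul_of_nonneg_left (sub_le_sub_left ?_ _) (nonsingProb_nonneg k)
    rw [Fintype.expect_eq_sum_div_card, Finset.sum_boole,
      div_le_iff₀ (by exact_mod_cast Fintype.card_pos)]
    have h₂ : (((Finset.univ.filter fun h => DegLT k (deriv₂ h f)).card : ℝ)) * 2 ^ (k + 1) ≤
        Fintype.card V := by exact_mod_cast card_degLT_deriv₂_le k hf hf'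
    rw [one_div, inv_pow, inv_mul_eq_div, le_div_iff₀ (by positivity)]
    exact h₂

/-- In dimension at most `k + m`, every function of degree at least `k` is rejected by the
`k`-fold derivative test with probability bounded below in terms of `m` only. -/
lemma le_rej_of_card_le {k m : ℕ} (hV : Fintype.card V ≤ 2 ^ (k + m)) {f : V → ZMod 2}
    (hf : ¬ DegLT k f) : 1 / 4 ≤ 2 ^ m * rej k f := by
  have hex := exists_degLT f
  have hk : k < Nat.find hex := by
    by_contra! h
    exact hf ((Nat.find_spec hex).mono h)
  obtain ⟨j, hj⟩ : ∃ j, Nat.find hex = k + j + 1 := ⟨Nat.find hex - k - 1, by omega⟩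
  have h₁ : DegLT (k + j + 1) f := hj ▸ Nat.find_spec hex
  have h₂ : ¬ DegLT (k + j) f := Nat.find_min hex (by omega)
  have hjm : k + j ≤ k + m :=
    (Nat.pow_le_pow_iff_right (by norm_num)).1 ((two_pow_le_card _ h₁ h₂).trans hV)
  calc (1 : ℝ) / 4 ≤ nonsingProb (k + j) := quarter_le_nonsingProb _
    _ ≤ rej (k + j) f := nonsingProb_le_rej _ h₁ h₂
    _ ≤ 2 ^ j * rej k f := rej_le_two_pow_mul _ _ _
    _ ≤ 2 ^ m * rej k f := mul_le_mul_of_nonneg_right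
        (pow_le_pow_right₀ (by norm_num) (by omega)) (rej_nonneg _ _)

end ExactDegree

section Hyperplanes

open scoped BigOperators
open Module (Dual)

variable {V : Type} [AddCommGroup V] [Module (ZMod 2) V]

section Cosets

variable {a : Dual (ZMod 2) V} {e : V}

/-- Parametrization of the coset `{x | a x = c}` by the kernel of `a`. -/
def cosetMap (a : Dual (ZMod 2) V) (e : V) (c : ZMod 2) (v : LinearMap.ker a) : V := v + c • e

lemma cosetMap_add (c : ZMod 2) (v h : LinearMap.ker a) :
    cosetMap a e c (v + h) = cosetMap a e c v + (h : V) := by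
  simp only [cosetMap, Submodule.coe_add]; abel

/-- The linear projection onto the kernel of `a` along `e`. -/
def kerProj (he : a e = 1) (x : V) : LinearMap.ker a :=
  ⟨x + a x • e, by
    have := CharTwo.add_self_eq_zero (a x)
    simp [he, this]⟩

lemma kerProj_add (he : a e = 1) (x h : V) :
    kerProj he (x + h) = kerProj he x + kerProj he h := by
  ext
  simp only [kerProj, Submodule.coe_add, map_add, add_smul]
  abel

lemma kerProj_cosetMap (he : a e = 1) (c : ZMod 2) (v : LinearMap.ker a) :
    kerProj he (cosetMap a e c v) = v := by
  ext
  have hv : a v = 0 := v.2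
  have : c • e + c • e = 0 := ZModModule.add_self _
  simp [kerProj, cosetMap, he, hv, add_assoc, this]

end Cosets

variable [Fintype V]

/-- The number of rejecting choices of the `k`-fold derivative test with all directions in the
kernel of `a`. -/
def rejKer (a : Dual (ZMod 2) V) : ℕ → (V → ZMod 2) → ℝ
  | 0, f => ∑ x, ind (f x)
  | k + 1, f => ∑ h ∈ Finset.univ.filter (fun h => a h = 0), rejKer a k (deriv₂ h f)

lemma rejKer_zero_fun (a : Dual (ZMod 2) V) (k : ℕ) : rejKer a k 0 = 0 := by
  induction k with
  | zero => simp [rejKer, ind_zero]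
  | succ k ih => simp [rejKer, deriv₂_zero, ih]

lemma rejKer_zero (k : ℕ) (f : V → ZMod 2) :
    rejKer 0 k f = (Fintype.card V : ℝ) ^ (k + 1) * rej k f := by
  induction k generalizing f with
  | zero => simp [rejKer, rej, dens]
  | succ k ih =>
    simp only [rejKer, rej, ih, LinearMap.zero_apply, Finset.filter_true, ← Finset.mul_sum]
    rw [← Fintype.card_mul_expect]
    ring

lemma two_pow_mul_sum_rejKer_le (k : ℕ) (f : V → ZMod 2) (A : Finset (Dual (ZMod 2) V))
    (hA : ∀ a ∈ A, ∀ b ∈ A, a + b ∈ A)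
    (hf : ∀ v, (∀ a ∈ A, a v = 0) → deriv₂ v f = 0) :
    2 ^ k * ∑ a ∈ A, rejKer a k f ≤ A.card * ((Fintype.card V : ℝ) ^ (k + 1) * rej k f) := by
  induction k generalizing f A with
  | zero => simp [rejKer, rej, dens]
  | succ k ih =>
    have hstep : ∀ h : V, 2 ^ (k + 1) * ∑ a ∈ A.filter (fun a => a h = 0),
        rejKer a k (deriv₂ h f) ≤
          A.card * ((Fintype.card V : ℝ) ^ (k + 1) * rej k (deriv₂ h f)) := by
      intro h
      have hnn : 0 ≤ (Fintype.card V : ℝ) ^ (k + 1) * rej k (deriv₂ h f) :=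
        mul_nonneg (by positivity) (rej_nonneg _ _)
      by_cases hall : ∀ a ∈ A, a h = 0
      · rw [hf h hall] at hnn ⊢
        simp only [rejKer_zero_fun, Finset.sum_const_zero, mul_zero]
        exact mul_nonneg (by positivity) hnn
      push Not at hall
      obtain ⟨a₀, ha₀, ha₀h⟩ := hall
      replace ha₀h : a₀ h = 1 := (ZMod2.cases _).resolve_left ha₀h
      have hmem : ∀ a, a ∈ A.filter (fun a => a h = 0) ↔ a ∈ A ∧ a h = 0 :=
        fun a => Finset.mem_filter
      have h₁ := ih (deriv₂ h f) (A.filter fun a => a h = 0) (by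
        simp only [hmem]
        rintro a ⟨ha, hah⟩ b ⟨hb, hbh⟩
        exact ⟨hA a ha b hb, by simp [hah, hbh]⟩) (by
        simp only [hmem]
        intro v hv
        have hcase : (∀ a ∈ A, a v = 0) ∨ ∀ a ∈ A, a (v + h) = 0 := by
          rcases ZMod2.cases (a₀ v) with h0 | h1
          · left
            intro a ha
            rcases ZMod2.cases (a h) with hah | hah
            · exact hv a ⟨ha, hah⟩
            · have := hv (a + a₀) ⟨hA a ha a₀ ha₀, by simp [hah, ha₀h, one_add_one₂]⟩
              simpa [h0] using this
          · right
            intro a ha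
            rcases ZMod2.cases (a h) with hah | hah
            · simp [hah, hv a ⟨ha, hah⟩]
            · have := hv (a + a₀) ⟨hA a ha a₀ ha₀, by simp [hah, ha₀h, one_add_one₂]⟩
              simpa [h1, hah] using this
        rcases hcase with hc | hc
        · rw [deriv₂_comm, hf v hc, deriv₂_zero]
        · have h₂ := deriv₂_add_dir (v + h) h f
          rw [add_assoc, ZModModule.add_self, add_zero, hf _ hc, zero_add, deriv₂_zero,
            add_zero] at h₂
          rw [← h₂, deriv₂_self])
      have h₂ : 2 * (A.filter fun a => a h = 0).card ≤ A.card := by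
        refine two_mul_card_le a₀ (Finset.filter_subset _ _) ?_ ?_
        · simp only [hmem]
          rintro a ⟨ha, -⟩
          exact hA a ha a₀ ha₀
        · simp only [hmem]
          rintro a ⟨-, hah⟩ ⟨-, hah'⟩
          simp [hah, ha₀h] at hah'
      have h₃ : (2 : ℝ) * (A.filter fun a => a h = 0).card ≤ A.card := by exact_mod_cast h₂
      calc _ = 2 * (2 ^ k * ∑ a ∈ A.filter (fun a => a h = 0), rejKer a k (deriv₂ h f)) := by ring
        _ ≤ 2 * ((A.filter fun a => a h = 0).card *
              ((Fintype.card V : ℝ) ^ (k + 1) * rej k (deriv₂ h f))) := by linarith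
        _ = 2 * (A.filter fun a => a h = 0).card *
              ((Fintype.card V : ℝ) ^ (k + 1) * rej k (deriv₂ h f)) := by ring
        _ ≤ _ := mul_le_mul_of_nonneg_right h₃ hnn
    have hswap : ∑ a ∈ A, rejKer a (k + 1) f =
        ∑ h : V, ∑ a ∈ A.filter (fun a => a h = 0), rejKer a k (deriv₂ h f) := by
      simp only [rejKer, Finset.sum_filter]
      exact Finset.sum_comm
    rw [hswap, Finset.mul_sum]
    refine (Finset.sum_le_sum fun h _ => hstep h).trans_eq ?_
    rw [← Finset.mul_sum, ← Finset.mul_sum, ← Fintype.card_mul_expect]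
    simp only [rej]
    ring

lemma card_dual : Fintype.card (Dual (ZMod 2) V) = Fintype.card V := by
  rw [Module.card_eq_pow_finrank (K := ZMod 2), Module.card_eq_pow_finrank (K := ZMod 2) (V := V),
    Subspace.dual_finrank_eq]

lemma two_pow_mul_sum_rejKer_univ_le (k : ℕ) (f : V → ZMod 2) :
    2 ^ k * ∑ a : Dual (ZMod 2) V, rejKer a k f ≤
      Fintype.card V * ((Fintype.card V : ℝ) ^ (k + 1) * rej k f) := by
  have h := two_pow_mul_sum_rejKer_le k f Finset.univ (fun _ _ _ _ => Finset.mem_univ _) (by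
    intro v hv
    have : v = 0 :=
      (Module.forall_dual_apply_eq_zero_iff (ZMod 2) v).1 fun a => hv a (Finset.mem_univ a)
    subst this
    funext x
    simpa [deriv₂] using CharTwo.add_self_eq_zero (f x))
  rwa [Finset.card_univ, card_dual] at h

section Restriction

variable {a : Dual (ZMod 2) V} {e : V}

lemma sum_filter_ker (g : V → ℝ) :
    ∑ h ∈ Finset.univ.filter (fun h => a h = 0), g h = ∑ v : LinearMap.ker a, g v :=
  Finset.sum_subtype _ (by simp) g

lemma sum_eq_sum_ker (he : a e = 1) (g : V → ℝ) :
    ∑ x, g x = ∑ v : LinearMap.ker a, g v + ∑ v : LinearMap.ker a, g (v + e) := by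
  rw [← sum_filter_ker, ← sum_filter_ker (fun x => g (x + e)),
    ← Finset.sum_filter_add_sum_filter_not Finset.univ (fun h => a h = 0)]
  congr 1
  refine Finset.sum_bij' (fun x _ => x + e) (fun x _ => x + e) ?_ ?_ ?_ ?_ ?_
  · intro x hx
    have : a x = 1 := (ZMod2.cases _).resolve_left (Finset.mem_filter.1 hx).2
    simp [this, he, one_add_one₂]
  · intro x hx
    have : a x = 0 := (Finset.mem_filter.1 hx).2
    simp [this, he]
  all_goals
    intro x _
    simp [add_assoc, ZModModule.add_self]

lemma card_eq_two_mul_card_ker (he : a e = 1) :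
    (Fintype.card V : ℝ) = 2 * Fintype.card (LinearMap.ker a) := by
  have := sum_eq_sum_ker he (fun _ => 1)
  simp only [Finset.sum_const, Finset.card_univ, nsmul_eq_mul, mul_one] at this
  linarith

lemma rejKer_eq (he : a e = 1) (k : ℕ) (f : V → ZMod 2) :
    rejKer a k f = (Fintype.card (LinearMap.ker a) : ℝ) ^ (k + 1) *
      (rej k (f ∘ cosetMap a e 0) + rej k (f ∘ cosetMap a e 1)) := by
  induction k generalizing f with
  | zero =>
    rw [rejKer, sum_eq_sum_ker he]
    simp only [rej, dens, ← Fintype.card_mul_expect, Function.comp, cosetMap, zero_smul, one_smul,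
      add_zero]
    ring
  | succ k ih =>
    simp only [rejKer, ih, rej, deriv₂_comp (cosetMap_add _)]
    rw [sum_filter_ker (fun h => (Fintype.card (LinearMap.ker a) : ℝ) ^ (k + 1) *
      (rej k (deriv₂ h f ∘ cosetMap a e 0) + rej k (deriv₂ h f ∘ cosetMap a e 1))),
      ← Finset.mul_sum, Finset.sum_add_distrib, ← Fintype.card_mul_expect,
      ← Fintype.card_mul_expect]
    ring

/-- A polynomial on a hyperplane extends to the whole space without increasing the degree. -/
lemma exists_extension (he : a e = 1) (k : ℕ) (c : ZMod 2) (f : V → ZMod 2)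
    {p : LinearMap.ker a → ZMod 2} (hp : DegLT k p) :
    ∃ P : V → ZMod 2, DegLT k P ∧
      𝔼 x, ind ((a x + c + 1) * (f x + P x)) = dens (f ∘ cosetMap a e c + p) / 2 := by
  refine ⟨p ∘ kerProj he, hp.comp (kerProj_add he), ?_⟩
  have hcard := card_eq_two_mul_card_ker he
  have hpos : (0 : ℝ) < Fintype.card (LinearMap.ker a) := by exact_mod_cast Fintype.card_pos
  have key : ∑ x, ind ((a x + c + 1) * (f x + (p ∘ kerProj he) x)) =
      ∑ v, ind ((f ∘ cosetMap a e c + p) v) := by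
    rw [sum_eq_sum_ker he]
    have h₀ : ∀ v : LinearMap.ker a, kerProj he (v : V) = v := fun v => by
      simpa [cosetMap] using kerProj_cosetMap he 0 v
    have h₁ : ∀ v : LinearMap.ker a, kerProj he ((v : V) + e) = v := fun v => by
      simpa [cosetMap] using kerProj_cosetMap he 1 v
    have hv : ∀ v : LinearMap.ker a, a v = 0 := fun v => v.2
    rcases ZMod2.cases c with rfl | rfl
    · simp [hv, he, h₀, h₁, cosetMap, one_add_one₂, ind_zero]
    · simp [hv, he, h₀, h₁, cosetMap, one_add_one₂, ind_zero]
  rw [Fintype.expect_eq_sum_div_card, key, dens, Fintype.expect_eq_sum_div_card, hcard]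
  field_simp

end Restriction

end Hyperplanes

section Interpolation

open scoped BigOperators
open Module (Dual)

variable {V : Type} [AddCommGroup V]

/-- The minimum distance of Reed–Muller codes. -/
lemma one_le_two_pow_mul_dens [Fintype V] (k : ℕ) {p : V → ZMod 2} (hp : DegLT (k + 1) p)
    (hne : p ≠ 0) : 1 ≤ 2 ^ k * dens p := by
  have hconst : ∀ q : V → ZMod 2, q ≠ 0 → (∀ x y, q x = q y) → dens q = 1 := by
    intro q hq hc
    obtain ⟨x, hx⟩ := Function.ne_iff.1 hq
    have : ∀ y, ind (q y) = 1 := fun y => by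
      rw [hc y x, (ZMod2.cases (q x)).resolve_left hx, ind_one]
    simp [dens, this]
  induction k generalizing p with
  | zero => simp [hconst p hne hp.eq_const]
  | succ k ih =>
    by_cases hd : ∃ h, deriv₂ h p ≠ 0
    · obtain ⟨h, hh⟩ := hd
      calc 1 ≤ 2 ^ k * dens (deriv₂ h p) := ih (hp h) hh
        _ ≤ 2 ^ k * (2 * dens p) :=
          mul_le_mul_of_nonneg_left (dens_deriv₂_le p h) (by positivity)
        _ = 2 ^ (k + 1) * dens p := by ring
    · push Not at hd
      have : DegLT 1 p := hd
      rw [hconst p hne this.eq_const, mul_one]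
      exact one_le_pow₀ (by norm_num)

variable [Module (ZMod 2) V]

/-- Each functional in the list takes the value `1` at some common zero of the later ones. -/
def IndepList : List (Dual (ZMod 2) V) → Prop
  | [] => True
  | a :: l => (∃ e, a e = 1 ∧ ∀ b ∈ l, b e = 0) ∧ IndepList l

lemma proj_add (a : Dual (ZMod 2) V) (c : ZMod 2) (e x h : V) :
    x + h + (a (x + h) + c) • e = x + (a x + c) • e + (h + a h • e) := by
  simp only [map_add, add_smul]
  abel

lemma apply_proj_self {a : Dual (ZMod 2) V} {e : V} (he : a e = 1) (c : ZMod 2) (x : V) :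
    a (x + (a x + c) • e) = c := by
  simp only [map_add, map_smul, he, smul_eq_mul, mul_one]
  generalize a x = u
  revert u c; decide

/-- Compatible polynomials on independent hyperplanes are restrictions of one polynomial. -/
lemma exists_patch {k : ℕ} (c : Dual (ZMod 2) V → ZMod 2) (P : Dual (ZMod 2) V → V → ZMod 2)
    (l : List (Dual (ZMod 2) V)) (hl : IndepList l) (hP : ∀ a ∈ l, DegLT k (P a))
    (hcomp : ∀ a ∈ l, ∀ b ∈ l, ∀ x, a x = c a → b x = c b → P a x = P b x) :
    ∃ Q, DegLT k Q ∧ ∀ a ∈ l, ∀ x, a x = c a → Q x = P a x := by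
  induction l with
  | nil => exact ⟨0, DegLT.zero k, by simp⟩
  | cons a l ih =>
    obtain ⟨⟨e, he, hle⟩, hl⟩ := hl
    obtain ⟨Q, hQ, hQl⟩ := ih hl (fun b hb => hP b (List.mem_cons_of_mem _ hb))
      fun b hb b' hb' => hcomp b (List.mem_cons_of_mem _ hb) b' (List.mem_cons_of_mem _ hb')
    refine ⟨Q + (P a + Q) ∘ fun x => x + (a x + c a) • e,
      hQ.add (((hP a List.mem_cons_self).add hQ).comp (proj_add a (c a) e)), ?_⟩
    intro b hb x hx
    simp only [Pi.add_apply, Function.comp]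
    rcases List.mem_cons.1 hb with rfl | hb'
    · rw [hx, CharTwo.add_self_eq_zero, zero_smul, add_zero]
      generalize Q x = u
      generalize P b x = v
      revert u v; decide
    · have hbx : b (x + (a x + c a) • e) = c b := by simp [hle b hb', hx]
      rw [hQl b hb' x hx, hQl b hb' _ hbx,
        hcomp a List.mem_cons_self b hb _ (apply_proj_self he _ _) hbx,
        CharTwo.add_self_eq_zero, add_zero]

/-- A polynomial of degree less than `k` vanishing on `k` independent hyperplanes is zero. -/
lemma eq_zero_of_vanish (c : Dual (ZMod 2) V → ZMod 2) (l : List (Dual (ZMod 2) V))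
    (hl : IndepList l) {g : V → ZMod 2} (hg : DegLT l.length g)
    (hvan : ∀ a ∈ l, ∀ x, a x = c a → g x = 0) : g = 0 := by
  induction l generalizing g with
  | nil => exact hg
  | cons a l ih =>
    obtain ⟨⟨e, he, hle⟩, hl⟩ := hl
    have hd : deriv₂ e g = 0 := ih hl (hg e) fun b hb x hx => by
      have hbx : b (x + e) = c b := by simp [hle b hb, hx]
      simp only [deriv₂, hvan b (List.mem_cons_of_mem _ hb) _ hx,
        hvan b (List.mem_cons_of_mem _ hb) _ hbx, add_zero]
    have hper : ∀ x, g (x + e) = g x := fun x => CharTwo.add_eq_zero.1 (congrFun hd x)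
    funext x
    have hz := hvan a List.mem_cons_self _ (apply_proj_self he (c a) x)
    rcases ZMod2.cases (a x + c a) with h | h
    · simpa [h] using hz
    · rw [h, one_smul, hper] at hz
      exact hz

variable [Fintype V]

lemma exists_indepList (S : Finset (Dual (ZMod 2) V)) (m : ℕ) (hS : 2 ^ m ≤ S.card) :
    ∃ l : List (Dual (ZMod 2) V), l.length = m ∧ (∀ a ∈ l, a ∈ S) ∧ IndepList l := by
  induction m with
  | zero => exact ⟨[], rfl, by simp, trivial⟩
  | succ m ih =>
    have hlt : 2 ^ m < S.card := lt_of_lt_of_le (Nat.pow_lt_pow_right (by norm_num) (by omega)) hS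
    obtain ⟨l, hlen, hlS, hl⟩ := ih hlt.le
    set L : Submodule (ZMod 2) (Dual (ZMod 2) V) := Submodule.span (ZMod 2) (Set.range l.get)
    have hcard : Fintype.card L ≤ 2 ^ m := by
      rw [Module.card_eq_pow_finrank (K := ZMod 2), ZMod.card]
      refine Nat.pow_le_pow_right (by norm_num) ?_
      have := finrank_range_le_card (R := ZMod 2) l.get
      rw [Fintype.card_fin] at this
      exact this.trans_eq hlen
    obtain ⟨a, haS, haL⟩ : ∃ a ∈ S, a ∉ L := by
      by_contra! h
      have : S.card ≤ Fintype.card L := by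
        rw [Fintype.card_subtype]
        exact Finset.card_le_card fun a ha => by simpa using h a ha
      omega
    refine ⟨a :: l, by simp [hlen], ?_, ?_, hl⟩
    · intro b hb
      rcases List.mem_cons.1 hb with rfl | hb
      · exact haS
      · exact hlS b hb
    · by_contra! hcon
      refine haL (mem_span_of_iInf_ker_le_ker fun e he => ?_)
      rw [Submodule.mem_iInf] at he
      by_contra hae
      obtain ⟨b, hb, hbe⟩ := hcon e ((ZMod2.cases _).resolve_left hae)
      obtain ⟨i, rfl⟩ := List.get_of_mem hb
      exact hbe (he i)

lemma expect_sgn_eq_zero {a : Dual (ZMod 2) V} (ha : a ≠ 0) (c : ZMod 2) :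
    𝔼 x, sgn (a x + c) = 0 := by
  obtain ⟨e, he⟩ : ∃ e, a e ≠ 0 := by
    by_contra! h
    exact ha (LinearMap.ext h)
  replace he := (ZMod2.cases _).resolve_left he
  have h₁ := expect_add_right (fun x => sgn (a x + c)) e
  have h₂ : ∀ x, sgn (a (x + e) + c) = -1 * sgn (a x + c) := fun x => by
    rw [map_add, he, add_right_comm, sgn_add, sgn_one]; ring
  simp only [h₂, ← Finset.mul_expect] at h₁
  linarith

/-- Parseval's identity for a signed sum of distinct characters. -/
lemma expect_sq_sum_sgn (S : Finset (Dual (ZMod 2) V)) (c : Dual (ZMod 2) V → ZMod 2) :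
    𝔼 x, (∑ a ∈ S, sgn (a x + c a)) ^ 2 = S.card := by
  have hpair : ∀ a b : Dual (ZMod 2) V, 𝔼 x, sgn (a x + c a) * sgn (b x + c b) =
      if a = b then 1 else 0 := by
    intro a b
    simp only [← sgn_add]
    split_ifs with hab
    · subst hab
      simp [CharTwo.add_self_eq_zero, sgn_zero]
    · have hne : a + b ≠ 0 := fun h => hab (by
        rw [← sub_eq_zero, ZModModule.sub_eq_add, h])
      rw [← expect_sgn_eq_zero hne (c a + c b)]
      refine Finset.expect_congr rfl fun x _ => ?_
      rw [LinearMap.add_apply, add_add_add_comm]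
  simp only [sq, Finset.sum_mul_sum, Finset.expect_sum_comm, hpair]
  simp

lemma ind_consistency (u v p q f : ZMod 2) :
    ind ((p + q) * u * v) ≤ ind (u * (f + p)) + ind (v * (f + q)) := by
  have h : (p + q) * u * v = v * (u * (f + p)) + u * (v * (f + q)) := by
    revert u v p q f; decide
  rw [h]
  refine (ind_add_le _ _).trans (add_le_add ?_ ?_)
  all_goals
    rw [ind_mul]
    exact mul_le_of_le_one_left (ind_nonneg _) (ind_le_one _)

/-- If `f` is close to polynomials of degree at most `d` on many hyperplanes with distinct
nonzero directions, it is close to one such polynomial globally. -/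
theorem exists_close_of_close_on_hyperplanes (d : ℕ) {τ : ℝ} (hτ : 2 ^ (d + 2) * τ < 1)
    (f : V → ZMod 2) (S : Finset (Dual (ZMod 2) V)) (hS : 2 ^ (d + 2) ≤ S.card)
    (c : Dual (ZMod 2) V → ZMod 2) (P : Dual (ZMod 2) V → V → ZMod 2)
    (hP : ∀ a ∈ S, DegLT (d + 1) (P a))
    (hclose : ∀ a ∈ S, 𝔼 x, ind ((a x + c a + 1) * (f x + P a x)) ≤ τ / 2) :
    ∃ Q, DegLT (d + 1) Q ∧ dens (f + Q) ≤ 2 * τ + 1 / S.card := by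
  have hlin : ∀ a : Dual (ZMod 2) V, DegLT 2 fun x => a x + c a + 1 := fun a =>
    DegLT.affine (b := a) fun x h => by rw [map_add]; ring
  have hone : ∀ (a : Dual (ZMod 2) V) x, a x = c a → a x + c a + 1 = 1 := fun a x hx => by
    rw [hx, CharTwo.add_self_eq_zero, zero_add]
  have hcomp : ∀ a ∈ S, ∀ b ∈ S, ∀ x, a x = c a → b x = c b → P a x = P b x := by
    intro a ha b hb
    have hz : (P a + P b) * (fun x => a x + c a + 1) * (fun x => b x + c b + 1) = 0 := by
      by_contra hne
      have h₁ := one_le_two_pow_mul_dens (d + 2)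
        ((((hP a ha).add (hP b hb)).mul (hlin a)).mul (hlin b)) hne
      have h₂ : dens ((P a + P b) * (fun x => a x + c a + 1) * (fun x => b x + c b + 1)) ≤
          τ / 2 + τ / 2 := by
        refine le_trans ?_ (add_le_add (hclose a ha) (hclose b hb))
        rw [← Finset.expect_add_distrib]
        exact Finset.expect_le_expect fun x _ => ind_consistency _ _ _ _ _
      have h₃ := mul_le_mul_of_nonneg_left h₂ (show (0 : ℝ) ≤ 2 ^ (d + 2) by positivity)
      linarith
    intro x hax hbx
    have := congrFun hz x
    simp only [Pi.mul_apply, Pi.add_apply, hone a x hax, hone b x hbx, mul_one,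
      Pi.zero_apply] at this
    exact CharTwo.add_eq_zero.1 this
  obtain ⟨l, hlen, hlS, hl⟩ := exists_indepList S (d + 2) hS
  obtain ⟨Q, hQ, hQl⟩ := exists_patch c P l hl (fun a ha => hP a (hlS a ha))
    fun a ha b hb => hcomp a (hlS a ha) b (hlS b hb)
  refine ⟨Q, hQ, ?_⟩
  have hQS : ∀ b ∈ S, ∀ x, (b x + c b + 1) * (f x + Q x) = (b x + c b + 1) * (f x + P b x) := by
    intro b hb x
    have hz : (Q + P b) * (fun x => b x + c b + 1) = 0 := by
      refine eq_zero_of_vanish c l hl (hlen ▸ (hQ.add (hP b hb)).mul (hlin b)) ?_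
      intro a ha y hy
      simp only [Pi.mul_apply, Pi.add_apply]
      by_cases hby : b y = c b
      · rw [hQl a ha y hy, hcomp a (hlS a ha) b hb y hy hby, CharTwo.add_self_eq_zero, zero_mul]
      · have : b y + c b + 1 = 0 := by
          revert hby
          generalize b y = u
          generalize c b = v
          revert u v; decide
        rw [this, mul_zero]
    have := congrFun hz x
    simp only [Pi.mul_apply, Pi.add_apply, Pi.zero_apply] at this
    revert this
    generalize b x + c b + 1 = u
    generalize f x = w
    generalize Q x = q
    generalize P b x = p
    revert u w q p; decide
  have hK : (0 : ℝ) < S.card := by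
    exact_mod_cast lt_of_lt_of_le (by positivity) hS
  have hpt : ∀ x, ind ((f + Q) x) ≤
      4 / S.card * ∑ a ∈ S, ind ((a x + c a + 1) * (f x + P a x)) +
        1 / S.card ^ 2 * (∑ a ∈ S, sgn (a x + c a)) ^ 2 := by
    intro x
    have h₁ : ∑ a ∈ S, ind ((a x + c a + 1) * (f x + P a x)) =
        (S.card + ∑ a ∈ S, sgn (a x + c a)) / 2 * ind ((f + Q) x) := by
      have : ∀ a ∈ S, ind ((a x + c a + 1) * (f x + P a x)) =
          (1 + sgn (a x + c a)) / 2 * ind ((f + Q) x) := by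
        intro a ha
        rw [← hQS a ha x, ind_mul, Pi.add_apply, ind_add _ 1, ind_one, sgn_eq]
        ring
      rw [Finset.sum_congr rfl this, ← Finset.sum_mul, ← Finset.sum_div, Finset.sum_add_distrib]
      simp
    rw [h₁]
    set s := ∑ a ∈ S, sgn (a x + c a)
    rcases ZMod2.cases ((f + Q) x) with h | h
    · rw [h, ind_zero, mul_zero, mul_zero, zero_add]
      positivity
    · rw [h, ind_one]
      have : 4 / (S.card : ℝ) * ((S.card + s) / 2 * 1) + 1 / S.card ^ 2 * s ^ 2 =
          1 + (s / S.card + 1) ^ 2 := by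
        field_simp
        ring
      rw [this]
      nlinarith [sq_nonneg (s / S.card + 1)]
  calc dens (f + Q) ≤ _ := Finset.expect_le_expect fun x _ => hpt x
    _ = 4 / S.card * ∑ a ∈ S, 𝔼 x, ind ((a x + c a + 1) * (f x + P a x)) +
        1 / S.card ^ 2 * S.card := by
      rw [Finset.expect_add_distrib, ← Finset.mul_expect, ← Finset.mul_expect,
        expect_sq_sum_sgn, Finset.expect_sum_comm]
    _ ≤ 4 / S.card * (S.card * (τ / 2)) + 1 / S.card ^ 2 * S.card := by
      have : ∑ a ∈ S, 𝔼 x, ind ((a x + c a + 1) * (f x + P a x)) ≤ S.card * (τ / 2) := by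
        simpa using Finset.sum_le_sum hclose
      gcongr
    _ = 2 * τ + 1 / S.card := by
      field_simp
      ring

end Interpolation

section Testing

open scoped BigOperators
open Module (Dual)

lemma le_rej_of_dens_le {V : Type} [AddCommGroup V] [Fintype V] (k : ℕ) (f : V → ZMod 2)
    (hf : 2 ^ k * dens f ≤ 3 / 4) : 2 ^ k * dens f / 4 ≤ rej k f := by
  refine le_trans ?_ (le_rej_of_dens k f)
  have h₀ : 0 ≤ 2 ^ k * dens f := mul_nonneg (by positivity) (dens_nonneg f)
  nlinarith [mul_nonneg h₀ (dens_nonneg f), mul_nonneg h₀ (sub_nonneg.2 hf)]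

/-- Averaging over hyperplanes: if `f` is rejected with probability at least `η` on both cosets of
the kernel of all but `K` nonzero functionals, then it is rejected with similar probability. -/
lemma le_rej_of_le_rej_restrict {V : Type} [AddCommGroup V] [Module (ZMod 2) V] [Fintype V]
    (k : ℕ) (f : V → ZMod 2) (S : Finset (Dual (ZMod 2) V)) {η : ℝ} (hη : 0 ≤ η)
    (hrej : ∀ a : Dual (ZMod 2) V, a ∉ S → ∀ e, a e = 1 → ∀ c,
      η ≤ rej k (f ∘ cosetMap a e c)) :
    (Fintype.card V - 1 - S.card) * η ≤ (Fintype.card V - 1) * rej k f := by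
  set M : ℝ := ((Fintype.card V : ℕ) : ℝ)
  have hM : 0 < M := by simp only [M]; exact_mod_cast Fintype.card_pos
  have hnn : ∀ a : Dual (ZMod 2) V, a ≠ 0 → 0 ≤ rejKer a k f ∧
      (a ∉ S → M ^ (k + 1) / 2 ^ k * η ≤ rejKer a k f) := by
    intro a ha
    obtain ⟨e, he⟩ : ∃ e, a e ≠ 0 := by
      by_contra! h
      exact ha (LinearMap.ext h)
    replace he := (ZMod2.cases _).resolve_left he
    have hc : (Fintype.card (LinearMap.ker a) : ℝ) = M / 2 := by
      have := card_eq_two_mul_card_ker he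
      simp only [M]; linarith
    rw [rejKer_eq he, hc]
    refine ⟨mul_nonneg (by positivity) (add_nonneg (rej_nonneg _ _) (rej_nonneg _ _)), ?_⟩
    intro haS
    calc M ^ (k + 1) / 2 ^ k * η = (M / 2) ^ (k + 1) * (η + η) := by
          rw [div_pow, pow_succ 2]; field_simp; ring
      _ ≤ _ := mul_le_mul_of_nonneg_left (add_le_add (hrej a haS e he 0) (hrej a haS e he 1))
          (by positivity)
  set T : Finset (Dual (ZMod 2) V) := (insert 0 S)ᶜ
  have hT : M - 1 - S.card ≤ T.card := by
    have h₁ : T.card + (insert 0 S).card = Fintype.card V := by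
      rw [Finset.card_compl_add_card, card_dual]
    have h₂ := Finset.card_insert_le (0 : Dual (ZMod 2) V) S
    have h₃ : Fintype.card V ≤ T.card + (S.card + 1) := by omega
    have : M ≤ T.card + (S.card + 1) := by simp only [M]; exact_mod_cast h₃
    linarith
  have hsum : M ^ (k + 1) * rej k f + T.card * (M ^ (k + 1) / 2 ^ k * η) ≤
      ∑ a : Dual (ZMod 2) V, rejKer a k f := by
    rw [← rejKer_zero, ← Finset.add_sum_erase _ _ (Finset.mem_univ (0 : Dual (ZMod 2) V))]
    refine add_le_add le_rfl ?_
    have hTS : ∀ a ∈ T, a ≠ 0 ∧ a ∉ S := by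
      intro a ha
      simpa [T] using ha
    calc T.card * (M ^ (k + 1) / 2 ^ k * η) ≤ ∑ a ∈ T, rejKer a k f := by
          simpa using Finset.card_nsmul_le_sum T (fun a => rejKer a k f) _
            fun a ha => (hnn a (hTS a ha).1).2 (hTS a ha).2
      _ ≤ _ := Finset.sum_le_sum_of_subset_of_nonneg
          (fun a ha => Finset.mem_erase.2 ⟨(hTS a ha).1, Finset.mem_univ a⟩)
          fun a ha _ => (hnn a (Finset.mem_erase.1 ha).1).1
  have htot := two_pow_mul_sum_rejKer_univ_le k f
  have h₁ : M ^ (k + 1) * (2 ^ k * rej k f + T.card * η) ≤ M ^ (k + 1) * (M * rej k f) := by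
    calc _ = 2 ^ k * (M ^ (k + 1) * rej k f + T.card * (M ^ (k + 1) / 2 ^ k * η)) := by
          field_simp
      _ ≤ 2 ^ k * ∑ a : Dual (ZMod 2) V, rejKer a k f :=
          mul_le_mul_of_nonneg_left hsum (by positivity)
      _ ≤ _ := htot
      _ = _ := by ring
  have h₂ := le_of_mul_le_mul_left h₁ (by positivity)
  have h₃ : rej k f ≤ 2 ^ k * rej k f :=
    le_mul_of_one_le_left (rej_nonneg _ _) (one_le_pow₀ (by norm_num))
  have h₄ := mul_le_mul_of_nonneg_right hT hη
  linarith

lemma not_degLT_of_far {V : Type} [AddCommGroup V] [Fintype V] {k : ℕ} {f : V → ZMod 2} {δ : ℝ}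
    (hδ : 0 ≤ δ) (hf : ∀ p, DegLT k p → δ < dens (f + p)) : ¬ DegLT k f := fun h => by
  have h₁ := hf f h
  rw [show f + f = 0 from funext fun x => CharTwo.add_self_eq_zero (f x)] at h₁
  simp only [dens, Pi.zero_apply, ind_zero, Finset.expect_const_zero] at h₁
  exact absurd h₁ (not_lt.2 hδ)

/-- Functions far from degree `d` are rejected with probability bounded below by a constant,
in dimension `d + 5 + m`. -/
lemma le_rej_of_far_aux (d m : ℕ) (V : Type) [AddCommGroup V] [Module (ZMod 2) V] [Fintype V]
    (hV : Fintype.card V = 2 ^ (d + 5 + m)) (f : V → ZMod 2)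
    (hf : ∀ p, DegLT (d + 1) p → 1 / 2 ^ (d + 3) < dens (f + p)) :
    1 / 128 * (1 + (1 / 2) ^ m) ≤ rej (d + 1) f := by
  induction m generalizing V with
  | zero =>
    have := le_rej_of_card_le (k := d + 1) (m := 4) (by rw [hV])
      (not_degLT_of_far (by positivity) hf)
    norm_num at this ⊢
    linarith
  | succ m ih =>
    set S : Finset (Dual (ZMod 2) V) := Finset.univ.filter fun a => ∃ c P, DegLT (d + 1) P ∧
      𝔼 x, ind ((a x + c + 1) * (f x + P x)) ≤ 1 / 2 ^ (d + 3) / 2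
    have hpow : (0 : ℝ) < 2 ^ (d + 3) := by positivity
    by_cases hS : 2 ^ (d + 3) ≤ S.card
    · have hex : ∀ a : Dual (ZMod 2) V, ∃ c P, a ∈ S → DegLT (d + 1) P ∧
          𝔼 x, ind ((a x + c + 1) * (f x + P x)) ≤ 1 / 2 ^ (d + 3) / 2 := by
        intro a
        by_cases ha : a ∈ S
        · obtain ⟨c, P, h⟩ := (Finset.mem_filter.1 ha).2
          exact ⟨c, P, fun _ => h⟩
        · exact ⟨0, 0, fun h => absurd h ha⟩
      choose c P hcP using hex
      obtain ⟨Q, hQ, hQf⟩ := exists_close_of_close_on_hyperplanes d (τ := 1 / 2 ^ (d + 3))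
        (by rw [pow_succ _ (d + 2)]; field_simp; norm_num) f S
        (le_trans (Nat.pow_le_pow_right (by norm_num) (by omega)) hS) c P
        (fun a ha => (hcP a ha).1) (fun a ha => (hcP a ha).2)
      have hSr : (1 : ℝ) / S.card ≤ 1 / 2 ^ (d + 3) :=
        one_div_le_one_div_of_le hpow (by exact_mod_cast hS)
      have hlow := hf Q hQ
      have hup : 2 ^ (d + 3) * dens (f + Q) ≤ 3 := by
        have : dens (f + Q) ≤ 3 * (1 / 2 ^ (d + 3)) := by linarith
        calc _ ≤ 2 ^ (d + 3) * (3 * (1 / (2 : ℝ) ^ (d + 3))) :=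
              mul_le_mul_of_nonneg_left this hpow.le
          _ = 3 := by field_simp
      have hlow' : 1 < 2 ^ (d + 3) * dens (f + Q) := by
        rw [div_lt_iff₀ hpow] at hlow
        linarith
      have hsplit : (2 : ℝ) ^ (d + 3) = 4 * 2 ^ (d + 1) := by ring
      rw [hsplit] at hup hlow'
      have hrej := le_rej_of_dens_le (d + 1) (f + Q) (by linarith)
      rw [rej_add_degLT f hQ] at hrej
      have : ((1 : ℝ) / 2) ^ (m + 1) ≤ 1 := pow_le_one₀ (by norm_num) (by norm_num)
      linarith
    · push Not at hS
      have hrest : ∀ a : Dual (ZMod 2) V, a ∉ S → ∀ e, a e = 1 → ∀ c,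
          1 / 128 * (1 + (1 / 2) ^ m) ≤ rej (d + 1) (f ∘ cosetMap a e c) := by
        intro a haS e he c
        refine ih (LinearMap.ker a) ?_ _ fun p hp => ?_
        · have h₁ := card_eq_two_mul_card_ker he
          have h₂ : Fintype.card V = 2 * Fintype.card (LinearMap.ker a) := by exact_mod_cast h₁
          rw [hV, ← add_assoc, pow_succ] at h₂
          omega
        · by_contra! hle
          obtain ⟨Q, hQ, hQf⟩ := exists_extension he (d + 1) c f hp
          exact haS (Finset.mem_filter.2 ⟨Finset.mem_univ a, c, Q, hQ, by rw [hQf]; linarith⟩)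
      have havg := le_rej_of_le_rej_restrict (d + 1) f S (by positivity) hrest
      have hM : (Fintype.card V : ℝ) = 8 * 2 ^ (d + 3) * 2 ^ m := by
        rw [hV]; push_cast; ring
      have hSr : (S.card : ℝ) ≤ 2 ^ (d + 3) := by exact_mod_cast hS.le
      have hK : (1 : ℝ) ≤ 2 ^ (d + 3) := one_le_pow₀ (by norm_num)
      have hy : ((1 : ℝ) / 2) ^ m ≤ 1 := pow_le_one₀ (by norm_num) (by norm_num)
      have hy₀ : (0 : ℝ) < (1 / 2) ^ m := by positivity
      have h2m : (1 : ℝ) ≤ 2 ^ m := one_le_pow₀ (by norm_num)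
      have hym : (2 : ℝ) ^ m * (1 / 2) ^ m = 1 := by
        rw [← mul_pow]; norm_num
      rw [hM] at havg
      rw [pow_succ]
      set y := ((1 : ℝ) / 2) ^ m
      set K := (2 : ℝ) ^ (d + 3)
      set z := (2 : ℝ) ^ m
      have hpos : 0 < 8 * K * z - 1 := by nlinarith
      refine le_of_mul_le_mul_left (le_trans ?_ havg) hpos
      have h₁ : (8 * K * z - 1 - K) * (1 / 128 * (1 + y)) ≤
          (8 * K * z - 1 - S.card) * (1 / 128 * (1 + y)) :=
        mul_le_mul_of_nonneg_right (by linarith) (by positivity)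
      refine le_trans ?_ h₁
      have h₂ : 8 * K * z * y = 8 * K := by rw [mul_assoc, hym, mul_one]
      nlinarith [mul_nonneg (sub_nonneg.2 hK) (sub_nonneg.2 hy)]

lemma le_rej_of_far (d n : ℕ) (V : Type) [AddCommGroup V] [Module (ZMod 2) V] [Fintype V]
    (hV : Fintype.card V = 2 ^ n) (f : V → ZMod 2)
    (hf : ∀ p, DegLT (d + 1) p → 1 / 2 ^ (d + 3) < dens (f + p)) :
    1 / 128 ≤ rej (d + 1) f := by
  rcases le_or_gt (d + 5) n with hn | hn
  · obtain ⟨m, rfl⟩ := Nat.exists_eq_add_of_le hn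
    refine le_trans ?_ (le_rej_of_far_aux d m V hV f hf)
    have : (0 : ℝ) < (1 / 2) ^ m := by positivity
    linarith
  · have := le_rej_of_card_le (k := d + 1) (m := 4)
      (by rw [hV]; exact Nat.pow_le_pow_right (by norm_num) (by omega))
      (not_degLT_of_far (by positivity) hf)
    norm_num at this
    linarith

end Testing

section Polynomials

variable {n : ℕ}

lemma DegLT.eval {d : ℕ} {p : MvPolynomial (Fin n) (ZMod 2)} (hp : p.totalDegree ≤ d) :
    DegLT (d + 1) fun x => MvPolynomial.eval x p := by
  have key : (fun x => MvPolynomial.eval x p) = ∑ m ∈ p.support,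
      (fun _ => p.coeff m) * ∏ i ∈ m.support, fun x : Fin n → ZMod 2 => x i := by
    funext x
    rw [MvPolynomial.eval_eq]
    simp only [Finset.sum_apply, Pi.mul_apply, Finset.prod_apply]
    refine Finset.sum_congr rfl fun m _ => congrArg _ (Finset.prod_congr rfl fun i hi => ?_)
    have hi' := Finsupp.mem_support_iff.1 hi
    rcases ZMod2.cases (x i) with h | h <;> simp [h, hi']
  rw [key]
  refine DegLT.sum _ fun m hm => ?_
  have hcard : m.support.card ≤ d := by
    refine le_trans ?_ ((MvPolynomial.le_totalDegree hm).trans hp)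
    rw [Finset.card_eq_sum_ones]
    exact Finset.sum_le_sum fun i hi => Nat.one_le_iff_ne_zero.2 (Finsupp.mem_support_iff.1 hi)
  have hprod : DegLT (m.support.card + 1) (∏ i ∈ m.support, fun x : Fin n → ZMod 2 => x i) :=
    DegLT.prod _ fun i _ => DegLT.affine (b := fun x => x i) fun _ _ => rfl
  exact ((DegLT.const (p.coeff m)).mul hprod).mono (by omega)

lemma DegLT.exists_mvPolynomial (s : Finset (Fin n)) {d : ℕ} {f : (Fin n → ZMod 2) → ZMod 2}
    (hf : DegLT (d + 1) f) (hs : ∀ x, f x = f fun i => if i ∈ s then x i else 0) :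
    ∃ p : MvPolynomial (Fin n) (ZMod 2), p.totalDegree ≤ d ∧
      ∀ x, MvPolynomial.eval x p = f x := by
  induction s using Finset.induction_on generalizing d f with
  | empty =>
    refine ⟨MvPolynomial.C (f 0), by simp, fun x => ?_⟩
    rw [MvPolynomial.eval_C, hs x]
    simp only [Finset.notMem_empty, if_false]
    rfl
  | insert i s hi ih =>
    set A : (Fin n → ZMod 2) → Fin n → ZMod 2 := fun x j => if j = i then 0 else x j
    set e : Fin n → ZMod 2 := Pi.single i 1
    have hA : ∀ x h, A (x + h) = A x + A h := by
      intro x h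
      funext j
      by_cases hj : j = i <;> simp [A, hj]
    have hmask : ∀ x (c : ZMod 2), f (A x + c • e) =
        f (A (fun j => if j ∈ s then x j else 0) + c • e) := by
      intro x c
      rw [hs]
      congr 1
      funext j
      by_cases hj : j = i
      · subst hj; simp [A, e]
      · simp [A, e, hj]
    have hmask₀ : ∀ x, f (A x) = f (A fun j => if j ∈ s then x j else 0) := fun x => by
      simpa using hmask x 0
    have hmask₁ : ∀ x, f (A x + e) = f (A (fun j => if j ∈ s then x j else 0) + e) := fun x => by
      simpa using hmask x 1
    have hsplit : ∀ x, f x = f (A x) + x i * deriv₂ e f (A x) := by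
      intro x
      rcases ZMod2.cases (x i) with h | h
      · have : A x = x := by
          funext j
          by_cases hj : j = i
          · subst hj; simp [A, h]
          · simp [A, hj]
        rw [h, this, zero_mul, add_zero]
      · have : A x + e = x := by
          funext j
          by_cases hj : j = i
          · subst hj; simp [A, e, h]
          · simp [A, e, hj]
        rw [h, one_mul, deriv₂, this, add_left_comm, CharTwo.add_self_eq_zero, add_zero]
    obtain ⟨p, hp, hpf⟩ := ih (hf.comp hA) hmask₀
    have hder := hf e
    cases d with
    | zero =>
      refine ⟨p, hp, fun x => ?_⟩
      rw [hpf, hsplit x, show deriv₂ e f = 0 from hder]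
      simp
    | succ d =>
      obtain ⟨q, hq, hqf⟩ := ih (hder.comp hA) fun x => by
        simp only [Function.comp, deriv₂]
        rw [hmask₀ x, hmask₁ x]
      refine ⟨p + MvPolynomial.X i * q, ?_, fun x => ?_⟩
      · refine (MvPolynomial.totalDegree_add _ _).trans (max_le hp ?_)
        refine (MvPolynomial.totalDegree_mul _ _).trans ?_
        rw [MvPolynomial.totalDegree_X]
        omega
      · rw [map_add, map_mul, MvPolynomial.eval_X, hpf, hqf, hsplit x]
        rfl

lemma degLE_iff_degLT {d : ℕ} {f : (Fin n → ZMod 2) → ZMod 2} :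
    degLE n d f ↔ DegLT (d + 1) f := by
  refine ⟨?_, fun h => h.exists_mvPolynomial Finset.univ fun x => by simp⟩
  rintro ⟨p, hp, hpf⟩
  rw [← funext hpf]
  exact DegLT.eval hp

lemma hdist_eq_dens (f g : (Fin n → ZMod 2) → ZMod 2) : hdist n f g = dens (f + g) := by
  have h : ∀ x, ind ((f + g) x) = if f x ≠ g x then 1 else 0 := by
    intro x
    by_cases hx : f x = g x <;> simp [ind, CharTwo.add_eq_zero, hx]
  simp only [hdist, dens, h, Fintype.expect_eq_sum_div_card, Finset.sum_boole, Fintype.card_pi,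
    ZMod.card, Finset.prod_const, Finset.card_univ, Fintype.card_fin]
  push_cast
  rfl

lemma deltaD_le {d : ℕ} {f p : (Fin n → ZMod 2) → ZMod 2} (hp : DegLT (d + 1) p) :
    deltaD n d f ≤ dens (f + p) := by
  refine csInf_le ⟨0, ?_⟩ ⟨p, degLE_iff_degLT.2 hp, (hdist_eq_dens f p).symm⟩
  rintro _ ⟨g, _, rfl⟩
  rw [hdist_eq_dens]
  exact dens_nonneg _

lemma le_deltaD {d : ℕ} {f : (Fin n → ZMod 2) → ZMod 2} {r : ℝ}
    (hr : ∀ p, DegLT (d + 1) p → r ≤ dens (f + p)) : r ≤ deltaD n d f := by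
  refine le_csInf ⟨_, 0, degLE_iff_degLT.2 (DegLT.zero _), rfl⟩ ?_
  rintro _ ⟨g, hg, rfl⟩
  rw [hdist_eq_dens]
  exact hr g (degLE_iff_degLT.1 hg)

lemma exists_deltaD_eq (d : ℕ) (f : (Fin n → ZMod 2) → ZMod 2) :
    ∃ p, DegLT (d + 1) p ∧ dens (f + p) = deltaD n d f := by
  obtain ⟨p, hp, hmin⟩ := Set.exists_min_image {p | DegLT (d + 1) p} (fun p => dens (f + p))
    (Set.toFinite _) ⟨0, DegLT.zero _⟩
  exact ⟨p, hp, le_antisymm (le_deltaD hmin) (deltaD_le hp)⟩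

lemma deltaD_nonneg (d : ℕ) (f : (Fin n → ZMod 2) → ZMod 2) : 0 ≤ deltaD n d f :=
  le_deltaD fun _ _ => dens_nonneg _

lemma min_le_rej (d : ℕ) (f : (Fin n → ZMod 2) → ZMod 2) :
    min (1 / 128) (2 ^ (d + 1) * deltaD n d f / 4) ≤ rej (d + 1) f := by
  obtain ⟨p, hp, hpf⟩ := exists_deltaD_eq d f
  by_cases hδ : deltaD n d f ≤ 1 / 2 ^ (d + 3)
  · refine (min_le_right _ _).trans ?_
    rw [← rej_add_degLT f hp, ← hpf]
    refine le_rej_of_dens_le (d + 1) _ ?_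
    have : 2 ^ (d + 1) * dens (f + p) ≤ 2 ^ (d + 1) * (1 / 2 ^ (d + 3)) :=
      mul_le_mul_of_nonneg_left (hpf.trans_le hδ) (by positivity)
    refine this.trans ?_
    rw [show (2 : ℝ) ^ (d + 3) = 2 ^ (d + 1) * 4 by ring]
    field_simp
    norm_num
  · push Not at hδ
    refine (min_le_left _ _).trans (le_rej_of_far d n _ ?_ f fun q hq => ?_)
    · simp [ZMod.card]
    · exact hδ.trans_le (deltaD_le hq)

end Polynomials

section Xor

variable {n : ℕ}

lemma gowersPow_xorPow (k t : ℕ) (f : (Fin n → ZMod 2) → ZMod 2) :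
    gowersPow k (xorPow n t f) = gowersPow k f ^ t := by
  let e : (Fin (t * n) → ZMod 2) ≃+ (Fin t → Fin n → ZMod 2) :=
    { toFun := fun x i j => x (finProdFinEquiv (i, j))
      invFun := fun y k => y (finProdFinEquiv.symm k).1 (finProdFinEquiv.symm k).2
      left_inv := fun x => by
        funext k
        exact congrArg x (finProdFinEquiv.apply_symm_apply k)
      right_inv := fun y => by
        funext i j
        simp only [Equiv.symm_apply_apply]
      map_add' := fun _ _ => rfl }
  calc gowersPow k (xorPow n t f) =
        gowersPow k ((fun y : Fin t → Fin n → ZMod 2 => ∑ i, f (y i)) ∘ e) := rfl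
    _ = ∏ _i : Fin t, gowersPow k f := by
        rw [gowersPow_comp_equiv, gowersPow_pi k fun _ => f]
    _ = gowersPow k f ^ t := by simp

lemma one_sub_rpow_div_two_le_deltaD (d t : ℕ) {f : (Fin n → ZMod 2) → ZMod 2} {m : ℝ}
    (hm₁ : m ≤ 1 / 2) (hm : 2 * m ≤ rej (d + 1) f) :
    (1 - (1 - 2 * m) ^ ((t : ℝ) / 2 ^ d)) / 2 ≤ deltaD (t * n) d (xorPow n t f) := by
  refine le_deltaD fun p hp => ?_
  have hbase : 0 ≤ 1 - 2 * m := by linarith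
  have hγ : 0 ≤ (1 - 2 * m) ^ ((t : ℝ) / 2 ^ d) := Real.rpow_nonneg hbase _
  have hβ : gowersPow 0 (xorPow n t f + p) = 1 - 2 * dens (xorPow n t f + p) := gowersPow_eq 0 _
  suffices h : gowersPow 0 (xorPow n t f + p) ≤ (1 - 2 * m) ^ ((t : ℝ) / 2 ^ d) by linarith
  have hγpow : ((1 - 2 * m) ^ ((t : ℝ) / 2 ^ d)) ^ 2 ^ (d + 1) = ((1 - 2 * m) ^ 2) ^ t := by
    have hexp : (t : ℝ) / 2 ^ d * ((2 ^ (d + 1) : ℕ) : ℝ) = ((2 * t : ℕ) : ℝ) := by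
      push_cast
      field_simp
      ring
    rw [← Real.rpow_natCast, ← Real.rpow_mul hbase, hexp, Real.rpow_natCast, pow_mul]
  have hgow₀ : 0 ≤ gowersPow (d + 1) f := (sq_nonneg _).trans (sq_gowersPow_le d f)
  have hgow : gowersPow (d + 1) f ≤ (1 - 2 * m) ^ 2 := by
    rw [gowersPow_eq]
    nlinarith [sq_nonneg m]
  refine le_of_not_gt fun hlt => ?_
  refine absurd (pow_lt_pow_left₀ hlt hγ (pow_ne_zero (d + 1) two_ne_zero)) (not_lt.2 ?_)
  calc gowersPow 0 (xorPow n t f + p) ^ 2 ^ (d + 1) ≤ gowersPow (d + 1) (xorPow n t f + p) :=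
        gowersPow_zero_pow_le d _
    _ = gowersPow (d + 1) f ^ t := by rw [gowersPow_add_degLT _ hp, gowersPow_xorPow]
    _ ≤ ((1 - 2 * m) ^ 2) ^ t := pow_le_pow_left₀ hgow₀ hgow t
    _ = _ := hγpow.symm

end Xor

theorem statement2 :
    ∃ ε₁ c : ℝ, 0 < ε₁ ∧ 0 < c ∧
      ∀ (d n t : ℕ), d + 1 ≤ n → 1 ≤ t →
        ∀ f : (Fin n → ZMod 2) → ZMod 2,
          (1 - (1 - 2 * min (ε₁ / 4) ((2:ℝ) ^ ((d:ℤ) - 2) * deltaD n d f))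
              ^ ((t : ℝ) / 2 ^ d)) / 2 ≤ deltaD (t * n) d (xorPow n t f) ∧
          (0.1 ≤ deltaD n d f →
            1 / 2 - (2:ℝ) ^ (-(c * t / 2 ^ d)) ≤ deltaD (t * n) d (xorPow n t f)) := by
  refine ⟨1 / 64, 1 / 128, by norm_num, by norm_num, fun d n t _ _ f => ?_⟩
  have hδ := deltaD_nonneg d f
  set δ := deltaD n d f
  have hzpow : (2 : ℝ) ^ ((d : ℤ) - 2) = 2 ^ d / 4 := by
    rw [zpow_sub₀ two_ne_zero, zpow_natCast]
    norm_num
  rw [hzpow]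
  set m := min ((1 : ℝ) / 64 / 4) (2 ^ d / 4 * δ)
  have hm₁ : m ≤ 1 / 256 := (min_le_left _ _).trans (by norm_num)
  have hm₂ : m ≤ 2 ^ d / 4 * δ := min_le_right _ _
  have hrej : 2 * m ≤ rej (d + 1) f := by
    refine le_trans (le_min (by linarith) ?_) (min_le_rej d f)
    rw [pow_succ]
    linarith
  have hmain := one_sub_rpow_div_two_le_deltaD d t (by linarith) hrej
  refine ⟨hmain, fun h01 => le_trans ?_ hmain⟩
  have hmeq : m = 1 / 256 := by
    refine le_antisymm hm₁ (le_min (by norm_num) ?_)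
    have : (1 : ℝ) ≤ 2 ^ d := one_le_pow₀ (by norm_num)
    norm_num at h01
    nlinarith
  have hbase : 1 - 2 * m ≤ (2 : ℝ) ^ (-(1 / 128) : ℝ) := by
    rw [hmeq, Real.rpow_def_of_pos two_pos]
    refine le_trans ?_ (Real.add_one_le_exp _)
    have := Real.log_two_lt_d9
    linarith
  have hpow : (1 - 2 * m) ^ ((t : ℝ) / 2 ^ d) ≤ (2 : ℝ) ^ (-(1 / 128 * (t : ℝ) / 2 ^ d)) := by
    refine (Real.rpow_le_rpow (by linarith) hbase (by positivity)).trans_eq ?_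
    rw [← Real.rpow_mul two_pos.le]
    congr 1
    ring
  have : 0 ≤ (2 : ℝ) ^ (-(1 / 128 * (t : ℝ) / 2 ^ d)) := by positivity
  linarith

end
end

section
/- For all integers d, ℓ, k, n with n ≥ k ≥ ℓ ≥ d+1 and every f : F₂ⁿ → F₂ with δ_d(f) = δ, one has Rej_{d,k}(f) ≥ 2^ℓ · δ · (1 − (2^ℓ − 1)·δ). In particular, if δ ≤ 2^{−(d+2)} then Rej_{d,k}(f) ≥ min{1/8, 2^{k−1} · δ}. -/
open scoped Classical

noncomputable section

open Finset

namespace degLE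

lemma comp_affine {n m d : ℕ} {g : (Fin n → ZMod 2) → ZMod 2} (hg : degLE n d g)
    (M : Matrix (Fin n) (Fin m) (ZMod 2)) (b : Fin n → ZMod 2) :
    degLE m d (fun u => g (M.mulVec u + b)) := by
  obtain ⟨p, hp, hpg⟩ := hg
  let q : Fin n → MvPolynomial (Fin m) (ZMod 2) := fun i =>
    ∑ j, MvPolynomial.C (M i j) * MvPolynomial.X j + MvPolynomial.C (b i)
  have hq : ∀ i, (q i).totalDegree ≤ 1 := by
    intro i
    refine (MvPolynomial.totalDegree_add _ _).trans (max_le ?_ (by simp))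
    refine MvPolynomial.totalDegree_finsetSum_le fun j _ => ?_
    refine (MvPolynomial.totalDegree_mul _ _).trans ?_
    simp
  refine ⟨MvPolynomial.aeval q p, ?_, fun u => ?_⟩
  · rw [MvPolynomial.aeval_def, MvPolynomial.eval₂_eq']
    refine MvPolynomial.totalDegree_finsetSum_le fun s hs => ?_
    refine (MvPolynomial.totalDegree_mul _ _).trans ?_
    have h1 : (∏ i, q i ^ s i).totalDegree ≤ ∑ i, s i := by
      refine (MvPolynomial.totalDegree_finsetProd _ _).trans (sum_le_sum fun i _ => ?_)
      refine (MvPolynomial.totalDegree_pow _ _).trans ?_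
      simpa using Nat.mul_le_mul_left (s i) (hq i)
    have h2 : ∑ i, s i ≤ d := by
      have := MvPolynomial.le_totalDegree hs
      rw [Finsupp.sum_fintype _ _ (fun _ => rfl)] at this
      exact this.trans hp
    have h3 : (algebraMap (ZMod 2) (MvPolynomial (Fin m) (ZMod 2)) (p.coeff s)).totalDegree = 0 :=
      MvPolynomial.totalDegree_C _
    omega
  · have : MvPolynomial.eval u (MvPolynomial.aeval q p)
        = MvPolynomial.eval (fun i => MvPolynomial.eval u (q i)) p := by
      rw [MvPolynomial.aeval_def, MvPolynomial.eval₂_eq', MvPolynomial.eval_eq' _ p]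
      simp [MvPolynomial.algebraMap_eq]
    rw [this, hpg]
    simp only
    congr 1
    funext i
    simp [q, Matrix.mulVec, dotProduct]

lemma sub {n d : ℕ} {f g : (Fin n → ZMod 2) → ZMod 2} (hf : degLE n d f) (hg : degLE n d g) :
    degLE n d (fun x => f x - g x) := by
  obtain ⟨p, hp, hpf⟩ := hf
  obtain ⟨q, hq, hqg⟩ := hg
  exact ⟨p - q, (MvPolynomial.totalDegree_sub _ _).trans (max_le hp hq), fun x => by
    rw [map_sub, hpf, hqg]⟩

lemma sum_eq_zero {n d : ℕ} {f : (Fin n → ZMod 2) → ZMod 2} (hf : degLE n d f) (hd : d < n) :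
    ∑ x, f x = 0 := by
  obtain ⟨p, hp, hpf⟩ := hf
  rw [← MvPolynomial.sum_eval_eq_zero p (by simpa [ZMod.card] using hp.trans_lt hd)]
  exact sum_congr rfl fun x _ => (hpf x).symm

end degLE

lemma exists_linearEquiv_apply_eq {K V : Type*} [Field K] [AddCommGroup V] [Module K V]
    [FiniteDimensional K V] {x y : V} (hx : x ≠ 0) (hy : y ≠ 0) : ∃ g : V ≃ₗ[K] V, g x = y := by
  obtain ⟨g, hg⟩ := Submodule.exists_linearEquiv_restrict_eq
    ((LinearEquiv.toSpanNonzeroSingleton K V x hx).symm ≪≫ₗ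
      LinearEquiv.toSpanNonzeroSingleton K V y hy)
  refine ⟨g, ?_⟩
  have h1 : LinearEquiv.toSpanNonzeroSingleton K V x hx 1
      = ⟨x, Submodule.mem_span_singleton_self x⟩ := by simp
  have := hg ⟨x, Submodule.mem_span_singleton_self x⟩
  rw [LinearEquiv.trans_apply, ← h1, LinearEquiv.symm_apply_apply, h1] at this
  simpa using this.symm

/-- The injective matrices, that is, the linear parts of parametrizations of `k`-flats. -/
def injMatrices (n k : ℕ) : Finset (Matrix (Fin n) (Fin k) (ZMod 2)) :=
  univ.filter fun M => Function.Injective M.mulVec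

lemma mem_injMatrices {n k : ℕ} {M : Matrix (Fin n) (Fin k) (ZMod 2)} :
    M ∈ injMatrices n k ↔ Function.Injective M.mulVec := by
  simp [injMatrices]

lemma exists_mem_injMatrices {n k : ℕ} (h : k ≤ n) : ∃ M, M ∈ injMatrices n k := by
  refine ⟨(1 : Matrix (Fin n) (Fin n) (ZMod 2)).submatrix id (Fin.castLE h),
    mem_injMatrices.2 fun u v huv => ?_⟩
  funext j
  have := congrFun huv (Fin.castLE h j)
  simpa [Matrix.mulVec, dotProduct, Matrix.one_apply] using this

lemma card_injMatrices_filter_le {n k : ℕ} (z : Fin k → ZMod 2) {a a' : Fin n → ZMod 2}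
    (ha : a ≠ 0) (ha' : a' ≠ 0) :
    #{M ∈ injMatrices n k | M.mulVec z = a} ≤ #{M ∈ injMatrices n k | M.mulVec z = a'} := by
  obtain ⟨g, hg⟩ := exists_linearEquiv_apply_eq (K := ZMod 2) ha ha'
  have hG : ∀ x, (LinearMap.toMatrix' g.toLinearMap).mulVec x = g x := fun x => by
    rw [← Matrix.toLin'_apply, Matrix.toLin'_toMatrix']; rfl
  have hGM : ∀ (M : Matrix (Fin n) (Fin k) (ZMod 2)) x,
      (LinearMap.toMatrix' g.toLinearMap * M).mulVec x = g (M.mulVec x) := fun M x => by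
    rw [← Matrix.mulVec_mulVec, hG]
  refine card_le_card_of_injOn (fun M => LinearMap.toMatrix' g.toLinearMap * M) ?_ ?_
  · intro M hM
    simp only [coe_filter, mem_injMatrices, Set.mem_ofPred_eq] at hM ⊢
    refine ⟨fun x y hxy => ?_, by rw [hGM, hM.2, hg]⟩
    simp only [hGM] at hxy
    exact hM.1 (g.injective hxy)
  · intro M _ M' _ h
    refine Matrix.ext_of_mulVec_single fun j => g.injective ?_
    rw [← hGM, ← hGM]
    exact congrArg (fun A => Matrix.mulVec A _) h

lemma card_injMatrices_filter {n k : ℕ} {z : Fin k → ZMod 2} (hz : z ≠ 0) {a : Fin n → ZMod 2}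
    (ha : a ≠ 0) :
    (#{M ∈ injMatrices n k | M.mulVec z = a} : ℝ) * (2 ^ n - 1) = #(injMatrices n k) := by
  have h := card_eq_sum_card_fiberwise (f := fun M => M.mulVec z) (s := injMatrices n k)
    (t := univ.filter fun b => b ≠ 0) (fun M hM => by
      refine mem_coe.2 (mem_filter.2 ⟨mem_univ _, fun h0 => ?_⟩)
      exact hz (mem_injMatrices.1 hM (by simpa using h0)))
  have hc : ∀ b ∈ univ.filter (fun b : Fin n → ZMod 2 => b ≠ 0),
      #{M ∈ injMatrices n k | M.mulVec z = b} = #{M ∈ injMatrices n k | M.mulVec z = a} :=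
    fun b hb => le_antisymm (card_injMatrices_filter_le z (mem_filter.1 hb).2 ha)
      (card_injMatrices_filter_le z ha (mem_filter.1 hb).2)
  have hN : (#(univ.filter fun b : Fin n → ZMod 2 => b ≠ 0) : ℝ) = 2 ^ n - 1 := by
    rw [filter_ne', card_erase_of_mem (mem_univ _), card_univ]
    simp [ZMod.card]
  rw [h, sum_congr rfl hc, sum_const, smul_eq_mul, Nat.cast_mul, hN, mul_comm]

/-- Two distinct points of the domain are mapped by a random injective affine map to a uniformly
random pair of distinct points. -/
lemma sum_card_pair {n k : ℕ} {v w : Fin k → ZMod 2} (hvw : v ≠ w) (E : Finset (Fin n → ZMod 2)) :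
    (∑ M ∈ injMatrices n k, (#{b | M.mulVec v + b ∈ E ∧ M.mulVec w + b ∈ E} : ℝ)) * (2 ^ n - 1)
      = #(injMatrices n k) * (#E * (#E - 1)) := by
  have h1 : ∀ M ∈ injMatrices n k, #{b | M.mulVec v + b ∈ E ∧ M.mulVec w + b ∈ E}
      = #{p ∈ E.offDiag | M.mulVec (w - v) = p.2 - p.1} := by
    intro M hM
    refine card_bij' (fun b _ => (M.mulVec v + b, M.mulVec w + b)) (fun p _ => p.1 - M.mulVec v)
      ?_ ?_ ?_ ?_
    · intro b hb
      simp only [mem_filter, mem_univ, true_and] at hb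
      simp only [mem_filter, mem_offDiag, hb, true_and, Matrix.mulVec_sub]
      refine ⟨fun h => hvw (mem_injMatrices.1 hM (add_right_cancel h)), by abel⟩
    · intro p hp
      simp only [mem_filter, mem_offDiag, Matrix.mulVec_sub] at hp
      simp only [mem_filter, mem_univ, true_and]
      refine ⟨by simpa using hp.1.1, ?_⟩
      have : M.mulVec w + (p.1 - M.mulVec v) = p.2 := by
        rw [add_sub_left_comm, hp.2]; abel
      rw [this]
      exact hp.1.2.1
    · intro b _
      simp
    · intro p hp
      simp only [mem_filter, Matrix.mulVec_sub] at hp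
      ext1
      · simp
      · simp only
        rw [add_sub_left_comm, hp.2]; abel
  have h2 : ∑ M ∈ injMatrices n k, #{b | M.mulVec v + b ∈ E ∧ M.mulVec w + b ∈ E}
      = ∑ p ∈ E.offDiag, #{M ∈ injMatrices n k | M.mulVec (w - v) = p.2 - p.1} := by
    rw [sum_congr rfl h1]
    simp only [card_filter]
    exact sum_comm
  rw [← Nat.cast_sum, h2, Nat.cast_sum, sum_mul]
  rw [sum_congr rfl (fun p hp => card_injMatrices_filter (sub_ne_zero.2 hvw.symm)
    (sub_ne_zero.2 (mem_offDiag.1 hp).2.2.symm))]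
  rw [sum_const, nsmul_eq_mul, offDiag_card, Nat.cast_sub (Nat.le_mul_self _)]
  push_cast
  ring

lemma sum_card_pair_le {n k : ℕ} (hn : 0 < n) {v w : Fin k → ZMod 2} (hvw : v ≠ w)
    (E : Finset (Fin n → ZMod 2)) :
    ∑ M ∈ injMatrices n k, (#{b | M.mulVec v + b ∈ E ∧ M.mulVec w + b ∈ E} : ℝ)
      ≤ #(injMatrices n k) * (#E ^ 2 / 2 ^ n) := by
  have h := sum_card_pair hvw E
  have hN : (2 : ℝ) ≤ 2 ^ n := by
    simpa using pow_le_pow_right₀ (by norm_num : (1 : ℝ) ≤ 2) hn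
  have hE : (#E : ℝ) ≤ 2 ^ n := by
    have := card_le_univ E
    rw [Fintype.card_fun, ZMod.card, Fintype.card_fin] at this
    exact_mod_cast this
  refine le_of_mul_le_mul_right (h.le.trans ?_) (by linarith : (0 : ℝ) < 2 ^ n - 1)
  rw [mul_assoc]
  refine mul_le_mul_of_nonneg_left ?_ (Nat.cast_nonneg _)
  rw [div_mul_eq_mul_div, le_div_iff₀ (by linarith)]
  nlinarith [mul_nonneg (Nat.cast_nonneg (α := ℝ) #E) (sub_nonneg.2 hE)]

/-- Bonferroni lower bound on the number of parametrized flats for which exactly one of the points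
indexed by `S` lies in `E`. -/
lemma le_card_exactly_one {n k : ℕ} (hn : 0 < n) (S : Finset (Fin k → ZMod 2))
    (E : Finset (Fin n → ZMod 2)) :
    #(injMatrices n k) * (#S * #E - (#S * #S - #S) * (#E ^ 2 / 2 ^ n))
      ≤ (#{Mb ∈ injMatrices n k ×ˢ univ | #{v ∈ S | Mb.1.mulVec v + Mb.2 ∈ E} = 1} : ℝ) := by
  have hpt : ∀ (M : Matrix (Fin n) (Fin k) (ZMod 2)) (b : Fin n → ZMod 2),
      (∑ v ∈ S, if M.mulVec v + b ∈ E then (1 : ℝ) else 0)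
        - ∑ p ∈ S.offDiag, (if M.mulVec p.1 + b ∈ E ∧ M.mulVec p.2 + b ∈ E then (1 : ℝ) else 0)
      ≤ if #{v ∈ S | M.mulVec v + b ∈ E} = 1 then 1 else 0 := by
    intro M b
    have h1 : {p ∈ S.offDiag | M.mulVec p.1 + b ∈ E ∧ M.mulVec p.2 + b ∈ E}
        = {v ∈ S | M.mulVec v + b ∈ E}.offDiag := by
      ext p
      simp only [mem_filter, mem_offDiag]
      tauto
    rw [sum_boole, sum_boole, h1, offDiag_card, Nat.cast_sub (Nat.le_mul_self _)]
    generalize #{v ∈ S | M.mulVec v + b ∈ E} = X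
    push_cast
    split_ifs with h
    · subst h; norm_num
    · rcases Nat.eq_zero_or_pos X with h0 | h0
      · subst h0; norm_num
      · have : (2 : ℝ) ≤ X := by exact_mod_cast (by omega : 2 ≤ X)
        nlinarith
  have hsum := sum_le_sum fun M (_ : M ∈ injMatrices n k) => sum_le_sum fun b
    (_ : b ∈ (univ : Finset (Fin n → ZMod 2))) => hpt M b
  rw [card_filter, Nat.cast_sum, sum_product]
  push_cast
  refine le_trans ?_ hsum
  simp only [sum_sub_distrib]
  have h1 : ∑ M ∈ injMatrices n k, ∑ b, ∑ v ∈ S, (if M.mulVec v + b ∈ E then (1 : ℝ) else 0)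
      = #(injMatrices n k) * (#S * #E) := by
    have : ∀ (M : Matrix (Fin n) (Fin k) (ZMod 2)) v,
        ∑ b, (if M.mulVec v + b ∈ E then (1 : ℝ) else 0) = #E := by
      intro M v
      refine (Equiv.sum_comp (Equiv.addLeft (M.mulVec v))
        (fun y => if y ∈ E then (1 : ℝ) else 0)).trans ?_
      simp
    rw [sum_congr rfl fun M _ => sum_comm]
    simp only [this, sum_const, nsmul_eq_mul]
  have h2 : ∑ M ∈ injMatrices n k, ∑ b, ∑ p ∈ S.offDiag,
        (if M.mulVec p.1 + b ∈ E ∧ M.mulVec p.2 + b ∈ E then (1 : ℝ) else 0)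
      ≤ (#S * #S - #S) * (#(injMatrices n k) * (#E ^ 2 / 2 ^ n)) := by
    rw [sum_congr rfl fun M _ => sum_comm, sum_comm]
    simp only [sum_boole]
    refine (sum_le_card_nsmul _ _ _ fun p hp =>
      sum_card_pair_le hn (mem_offDiag.1 hp).2.2 E).trans_eq ?_
    rw [nsmul_eq_mul, offDiag_card, Nat.cast_sub (Nat.le_mul_self _)]
    push_cast
    rfl
  rw [h1]
  linarith

lemma exists_degLE_hdist_eq_deltaD (n d : ℕ) (f : (Fin n → ZMod 2) → ZMod 2) :
    ∃ g, degLE n d g ∧ deltaD n d f = hdist n f g := by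
  have hne : {r : ℝ | ∃ g, degLE n d g ∧ r = hdist n f g}.Nonempty :=
    ⟨_, 0, ⟨0, by simp, by simp⟩, rfl⟩
  refine hne.csInf_mem ((Set.finite_range (hdist n f)).subset ?_)
  rintro r ⟨g, _, rfl⟩
  exact ⟨g, rfl⟩

/-- If exactly one point of an `ℓ`-dimensional coordinate subspace of the flat is mapped to the
disagreement set of `f` and `g`, then `f` has degree larger than `d` on the flat. -/
lemma not_degLE_of_card_eq_one {n d k ℓ : ℕ} (hd : d < ℓ) {f g : (Fin n → ZMod 2) → ZMod 2}
    (hg : degLE n d g) (M : Matrix (Fin n) (Fin k) (ZMod 2)) (b : Fin n → ZMod 2)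
    {J : Matrix (Fin k) (Fin ℓ) (ZMod 2)} (hJ : Function.Injective J.mulVec)
    (h : #{v ∈ univ.image J.mulVec | M.mulVec v + b ∈ univ.filter fun x => f x ≠ g x} = 1) :
    ¬ degLE k d (fun u => f (M.mulVec u + b)) := by
  intro hf
  have h0 := ((hf.sub (hg.comp_affine M b)).comp_affine J 0).sum_eq_zero hd
  simp only [add_zero] at h0
  rw [← sum_image (s := univ) (g := J.mulVec)
    (f := fun v => f (M.mulVec v + b) - g (M.mulVec v + b)) (fun _ _ _ _ h => hJ h)] at h0
  have hval : ∀ x : Fin n → ZMod 2, f x - g x = if f x ≠ g x then 1 else 0 := by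
    intro x
    generalize f x = s
    generalize g x = t
    revert s t
    decide
  simp only [hval, sum_boole] at h0
  simp only [mem_filter, mem_univ, true_and] at h
  rw [h] at h0
  exact absurd h0 (by decide)

theorem Rej_ge (d ℓ k n : ℕ) (hd : d + 1 ≤ ℓ) (hℓ : ℓ ≤ k) (hk : k ≤ n)
    (f : (Fin n → ZMod 2) → ZMod 2) :
    (2 : ℝ) ^ ℓ * deltaD n d f * (1 - ((2 : ℝ) ^ ℓ - 1) * deltaD n d f) ≤ Rej n d k f := by
  obtain ⟨g, hg, hδ⟩ := exists_degLE_hdist_eq_deltaD n d f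
  rw [hδ, hdist]
  set E := univ.filter fun x => f x ≠ g x with hE
  obtain ⟨J, hJ⟩ := exists_mem_injMatrices hℓ
  rw [mem_injMatrices] at hJ
  have hmain := le_card_exactly_one (k := k) (by omega : 0 < n) (univ.image J.mulVec) E
  have hS : (#(univ.image J.mulVec) : ℝ) = 2 ^ ℓ := by
    rw [card_image_of_injective _ hJ, card_univ]
    simp [ZMod.card]
  rw [hS] at hmain
  have hden : ((univ.filter fun Mb : Matrix (Fin n) (Fin k) (ZMod 2) × (Fin n → ZMod 2) =>
      Function.Injective Mb.1.mulVec).card : ℝ) = #(injMatrices n k) * 2 ^ n := by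
    have : (univ.filter fun Mb : Matrix (Fin n) (Fin k) (ZMod 2) × (Fin n → ZMod 2) =>
        Function.Injective Mb.1.mulVec) = injMatrices n k ×ˢ univ := by
      ext Mb
      simp [mem_injMatrices]
    rw [this, card_product, card_univ]
    simp [ZMod.card]
  have hP : (0 : ℝ) < #(injMatrices n k) := by
    exact_mod_cast card_pos.2 (exists_mem_injMatrices hk)
  rw [Rej, hden, le_div_iff₀ (by positivity)]
  refine le_trans (le_of_eq ?_) (hmain.trans ?_)
  · field_simp
  · refine Nat.cast_le.2 (card_le_card fun Mb hMb => ?_)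
    simp only [mem_filter, mem_product, mem_injMatrices, mem_univ, true_and, and_true] at hMb ⊢
    refine ⟨hMb.1, not_degLE_of_card_eq_one hd hg Mb.1 Mb.2 hJ ?_⟩
    simpa only [hE, mem_filter, mem_univ, true_and] using hMb.2

theorem statement3 (d ℓ k n : ℕ) (hd : d + 1 ≤ ℓ) (hℓ : ℓ ≤ k) (hk : k ≤ n)
    (f : (Fin n → ZMod 2) → ZMod 2) (δ : ℝ) (hδ : deltaD n d f = δ) :
    (2:ℝ) ^ ℓ * δ * (1 - ((2:ℝ) ^ ℓ - 1) * δ) ≤ Rej n d k f ∧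
      (δ ≤ (2:ℝ) ^ (-(d:ℤ) - 2) →
        min (1/8) ((2:ℝ) ^ ((k:ℤ) - 1) * δ) ≤ Rej n d k f) := by
  subst hδ
  refine ⟨Rej_ge d ℓ k n hd hℓ hk f, fun hδ => ?_⟩
  set δ := deltaD n d f with hδ'
  have hδ0 : 0 ≤ δ := by
    obtain ⟨g, _, hg⟩ := exists_degLE_hdist_eq_deltaD n d f
    rw [hδ', hg, hdist]
    positivity
  have hbase : (2 : ℝ) ^ (d + 1) * δ ≤ 1 / 2 := by
    calc (2 : ℝ) ^ (d + 1) * δ ≤ 2 ^ (d + 1) * (2 : ℝ) ^ (-(d:ℤ) - 2) := by gcongr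
      _ = 1 / 2 := by
        rw [← zpow_natCast, ← zpow_add₀ two_ne_zero]
        have : ((d + 1 : ℕ) : ℤ) + (-(d:ℤ) - 2) = -1 := by push_cast; ring
        rw [this]
        norm_num
  by_cases hkδ : (2 : ℝ) ^ k * δ ≤ 1 / 2
  · refine (min_le_right _ _).trans (le_trans ?_ (Rej_ge d k k n (hd.trans hℓ) le_rfl hk f))
    rw [← hδ', zpow_sub₀ two_ne_zero, zpow_natCast, zpow_one]
    have : 0 ≤ (2 : ℝ) ^ k * δ := by positivity
    nlinarith
  · obtain ⟨m, hm, hmk, hmin⟩ : ∃ m, (2 : ℝ) ^ m * δ ≤ 1 / 2 ∧ m + 1 ≤ k ∧ d + 1 ≤ m ∧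
        1 / 2 < (2 : ℝ) ^ (m + 1) * δ := by
      by_contra! hcon
      refine hkδ (Nat.le_induction (m := d + 1) (P := fun m _ => m ≤ k → (2 : ℝ) ^ m * δ ≤ 1 / 2)
        (fun _ => hbase) (fun m hm ih hmk => ?_) k (hd.trans hℓ) le_rfl)
      exact hcon m (ih (by omega)) hmk hm
    refine (min_le_left _ _).trans (le_trans ?_
      (Rej_ge d m k n hmin.1 (by omega) hk f))
    rw [← hδ']
    have h2 := hmin.2
    rw [pow_succ] at h2
    nlinarith [mul_nonneg (sub_nonneg.2 hm) (by linarith : (0:ℝ) ≤ (2 : ℝ) ^ m * δ - 1 / 4)]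

end
end

section
/- For all integers n, d, k, k' with n ≥ k ≥ k' ≥ d+1 and every f : F₂ⁿ → F₂, one has Rej_{d,k'}(f) ≥ Rej_{d,k}(f) · 2^{−(k−k')}. -/
open scoped Classical

noncomputable section

section Degree

variable {n d e : ℕ} {f g : (Fin n → ZMod 2) → ZMod 2}

theorem degLE.mono (hf : degLE n d f) (h : d ≤ e) : degLE n e f := by
  obtain ⟨p, hp, hpf⟩ := hf
  exact ⟨p, hp.trans h, hpf⟩

theorem degLE_const (c : ZMod 2) : degLE n d fun _ => c :=
  ⟨MvPolynomial.C c, by simp, by simp⟩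

theorem degLE_coord (i : Fin n) : degLE n 1 fun x => x i :=
  ⟨MvPolynomial.X i, by simp, by simp⟩

theorem degLE.add (hf : degLE n d f) (hg : degLE n d g) : degLE n d fun x => f x + g x := by
  obtain ⟨p, hp, hpf⟩ := hf
  obtain ⟨q, hq, hqg⟩ := hg
  exact ⟨p + q, (MvPolynomial.totalDegree_add p q).trans (max_le hp hq), by simp [hpf, hqg]⟩

theorem degLE.mul (hf : degLE n d f) (hg : degLE n e g) : degLE n (d + e) fun x => f x * g x := by
  obtain ⟨p, hp, hpf⟩ := hf
  obtain ⟨q, hq, hqg⟩ := hg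
  exact ⟨p * q, (MvPolynomial.totalDegree_mul p q).trans (add_le_add hp hq), by simp [hpf, hqg]⟩

theorem degLE_pow (hf : degLE n 1 f) (m : ℕ) : degLE n m fun x => f x ^ m := by
  induction m with
  | zero => simpa using degLE_const 1
  | succ m ih => simpa [pow_succ] using ih.mul hf

theorem degLE_sum {ι : Type*} (s : Finset ι) (F : ι → (Fin n → ZMod 2) → ZMod 2)
    (h : ∀ i ∈ s, degLE n d (F i)) : degLE n d fun x => ∑ i ∈ s, F i x := by
  induction s using Finset.cons_induction with
  | empty => simpa using degLE_const 0
  | cons a s ha ih =>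
    simp only [Finset.sum_cons]
    exact (h a (by simp)).add (ih fun i hi => h i (by simp [hi]))

theorem degLE_prod {ι : Type*} (s : Finset ι) (F : ι → (Fin n → ZMod 2) → ZMod 2) (m : ι → ℕ)
    (h : ∀ i ∈ s, degLE n (m i) (F i)) :
    degLE n (∑ i ∈ s, m i) fun x => ∏ i ∈ s, F i x := by
  induction s using Finset.cons_induction with
  | empty => simpa using degLE_const 1
  | cons a s ha ih =>
    simp only [Finset.sum_cons, Finset.prod_cons]
    exact (h a (by simp)).mul (ih fun i hi => h i (by simp [hi]))

theorem degLE_linear (L : Fin n → ZMod 2) (b : ZMod 2) : degLE n 1 fun x => L ⬝ᵥ x + b := by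
  refine degLE.add (degLE_sum _ (fun i x => L i * x i) fun i _ => ?_) (degLE_const b)
  simpa using (degLE_const (n := n) (d := 0) (L i)).mul (degLE_coord i)

theorem sum_le_of_mem_support {p : MvPolynomial (Fin n) (ZMod 2)} (hp : p.totalDegree ≤ d)
    {m : Fin n →₀ ℕ} (hm : m ∈ p.support) : ∑ i, m i ≤ d := by
  have := (MvPolynomial.le_totalDegree hm).trans hp
  rwa [Finsupp.sum_fintype _ _ fun _ => rfl] at this

/-- The degree does not increase under a substitution of affine functions. -/
theorem degLE.comp (hf : degLE n d f) {m : ℕ} (R : (Fin m → ZMod 2) → Fin n → ZMod 2)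
    (hR : ∀ i, degLE m 1 fun x => R x i) : degLE m d fun x => f (R x) := by
  obtain ⟨p, hp, hpf⟩ := hf
  simp only [← hpf, MvPolynomial.eval_eq']
  refine degLE_sum _ _ fun c hc => ?_
  have h := (degLE_const (n := m) (d := 0) (p.coeff c)).mul
    (degLE_prod Finset.univ (fun i x => R x i ^ c i) c fun i _ => degLE_pow (hR i) (c i))
  exact h.mono (by simpa using sum_le_of_mem_support hp hc)

/-- The indicator vector of a finite set of coordinates. -/
def indVec (T : Finset (Fin n)) : Fin n → ZMod 2 := fun i => if i ∈ T then 1 else 0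

/-- The coefficient of the monomial `∏ i ∈ S, x i` in the multilinear form of `f`. -/
def moebius (f : (Fin n → ZMod 2) → ZMod 2) (S : Finset (Fin n)) : ZMod 2 :=
  ∑ T ∈ S.powerset, f (indVec T)

theorem moebius_eq_zero (hf : degLE n d f) {S : Finset (Fin n)} (hS : d < S.card) :
    moebius f S = 0 := by
  obtain ⟨p, hp, hpf⟩ := hf
  simp only [moebius, ← hpf, MvPolynomial.eval_eq']
  rw [Finset.sum_comm]
  refine Finset.sum_eq_zero fun m hm => ?_
  obtain ⟨i, hi, hmi⟩ : ∃ i ∈ S, m i = 0 := by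
    by_contra! h
    have h1 : S.card ≤ ∑ i ∈ S, m i := by
      rw [Finset.card_eq_sum_ones]
      exact Finset.sum_le_sum fun i hi => Nat.one_le_iff_ne_zero.2 (h i hi)
    have h2 : ∑ i ∈ S, m i ≤ ∑ i, m i := Finset.sum_le_univ_sum_of_nonneg fun _ => Nat.zero_le _
    have h3 := sum_le_of_mem_support hp hm
    omega
  rw [← Finset.insert_erase hi, Finset.sum_powerset_insert (Finset.notMem_erase i S),
    ← Finset.sum_add_distrib]
  refine Finset.sum_eq_zero fun T _ => ?_
  have : ∏ j, indVec (insert i T) j ^ m j = ∏ j, indVec T j ^ m j := by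
    refine Finset.prod_congr rfl fun j _ => ?_
    by_cases hj : j = i
    · subst hj; simp [hmi]
    · simp [indVec, hj]
  rw [this, CharTwo.add_self_eq_zero]

theorem sum_moebius (f : (Fin n → ZMod 2) → ZMod 2) (X : Finset (Fin n)) :
    ∑ S ∈ X.powerset, moebius f S = f (indVec X) := by
  simp only [moebius]
  rw [Finset.sum_comm' (t' := X.powerset) (s' := fun T => Finset.Icc T X)]
  · simp only [Finset.sum_const]
    rw [Finset.sum_eq_single_of_mem X (by simp)]
    · simp
    · intro T hT hne
      rw [Finset.mem_powerset] at hT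
      rw [Finset.card_Icc_finset hT]
      have h : X.card - T.card ≠ 0 := by
        have := Finset.card_lt_card (hT.ssubset_of_ne hne)
        omega
      rw [nsmul_eq_mul, Nat.cast_pow, CharP.cast_eq_zero, zero_pow h, zero_mul]
  · intro S T
    simp only [Finset.mem_powerset, Finset.mem_Icc]
    exact ⟨fun h => ⟨⟨h.2, h.1⟩, h.2.trans h.1⟩, fun h => ⟨h.1.2, h.1.1⟩⟩

theorem degLE_of_moebius (h : ∀ S : Finset (Fin n), d < S.card → moebius f S = 0) :
    degLE n d f := by
  have key : f = fun x => ∑ S : Finset (Fin n), moebius f S * ∏ i ∈ S, x i := by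
    funext x
    have hx : x = indVec (Finset.univ.filter fun i => x i = 1) := by
      funext i
      have : ∀ a : ZMod 2, a = if a = 1 then 1 else 0 := by decide
      simpa [indVec] using this (x i)
    rw [show f x = f (indVec _) from congrArg f hx, ← sum_moebius f]
    rw [← Finset.sum_subset (Finset.subset_univ _)]
    · refine Finset.sum_congr rfl fun S hS => ?_
      rw [Finset.prod_eq_one, mul_one]
      intro i hi
      simpa using Finset.mem_powerset.1 hS hi
    · intro S _ hS
      rw [Finset.mem_powerset, Finset.not_subset] at hS
      obtain ⟨i, hi, hix⟩ := hS
      have h01 : ∀ a : ZMod 2, a ≠ 1 → a = 0 := by decide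
      rw [Finset.prod_eq_zero hi (h01 _ (by simpa using hix)), mul_zero]
  rw [key]
  refine degLE_sum _ _ fun S _ => ?_
  by_cases hS : d < S.card
  · simpa [h S hS] using degLE_const (n := n) (d := d) 0
  · have := (degLE_const (n := n) (d := 0) (moebius f S)).mul
      (degLE_prod S (fun i x => x i) (fun _ => 1) fun i _ => degLE_coord i)
    exact this.mono (by simpa using hS)

theorem moebius_mul_coord_add_one {S : Finset (Fin n)} {i : Fin n} (hi : i ∉ S) :
    moebius (fun x => f x * (x i + 1)) (insert i S) = moebius f S := by
  rw [moebius, Finset.sum_powerset_insert hi]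
  have h2 : (1 : ZMod 2) + 1 = 0 := by decide
  rw [Finset.sum_eq_zero (s := S.powerset) (f := fun T => f (indVec (insert i T)) * _), add_zero]
  · refine Finset.sum_congr rfl fun T hT => ?_
    have hiT : i ∉ T := fun h => hi (Finset.mem_powerset.1 hT h)
    simp [indVec, hiT]
  · intro T _
    simp [indVec, h2]

/-- A function has degree at most `d` as soon as its products with all affine functions have
degree at most `d + 1`, provided `d + 1 < n`. -/
theorem degLE_of_mul_affine (hd : d + 1 < n)
    (h : ∀ (L : Fin n → ZMod 2) (b : ZMod 2), degLE n (d + 1) fun x => f x * (L ⬝ᵥ x + b)) :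
    degLE n d f := by
  refine degLE_of_moebius fun S hS => ?_
  by_cases hSu : S = Finset.univ
  · have h1 := h 0 1
    simp only [zero_dotProduct, zero_add, mul_one] at h1
    exact moebius_eq_zero h1 (by simpa [hSu] using hd)
  · obtain ⟨i, hi⟩ : ∃ i, i ∉ S := by
      by_contra! hall
      exact hSu (Finset.eq_univ_iff_forall.2 hall)
    rw [← moebius_mul_coord_add_one hi]
    have h1 := h (Pi.single i 1) 1
    simp only [single_dotProduct, one_mul] at h1
    refine moebius_eq_zero h1 ?_
    rw [Finset.card_insert_of_notMem hi]
    omega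

end Degree

section Flats

/-- Every hyperplane `L ⬝ᵥ x + b = 1` has an affine parametrization with an affine inverse. -/
theorem exists_hyperplane_param {k : ℕ} {L : Fin (k + 1) → ZMod 2} (hL : L ≠ 0) (b : ZMod 2) :
    ∃ (N : Matrix (Fin (k + 1)) (Fin k) (ZMod 2)) (c : Fin (k + 1) → ZMod 2)
      (R : Matrix (Fin k) (Fin (k + 1)) (ZMod 2)), Function.Injective N.mulVec ∧
      ∀ x, L ⬝ᵥ x + b = 1 → N.mulVec (R.mulVec (x - c)) + c = x := by
  let φ : Module.Dual (ZMod 2) (Fin (k + 1) → ZMod 2) := dotProductBilin (ZMod 2) (ZMod 2) L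
  have hφ : ∀ x, φ x = L ⬝ᵥ x := fun _ => rfl
  have hφ0 : φ ≠ 0 := by
    intro h
    refine hL (funext fun i => ?_)
    simpa [hφ] using LinearMap.congr_fun h (Pi.single i 1)
  have hrank : Module.finrank (ZMod 2) (Fin k → ZMod 2) =
      Module.finrank (ZMod 2) (LinearMap.ker φ) := by
    have := Module.Dual.finrank_ker_add_one_of_ne_zero hφ0
    simp only [Module.finrank_fin_fun] at this ⊢
    omega
  let ε := LinearEquiv.ofFinrankEq _ _ hrank
  let N := (LinearMap.ker φ).subtype ∘ₗ ε.toLinearMap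
  have hN : Function.Injective N := Subtype.val_injective.comp ε.injective
  obtain ⟨R, hR⟩ := N.exists_leftInverse_of_injective (LinearMap.ker_eq_bot.2 hN)
  obtain ⟨c, hc⟩ := LinearMap.surjective hφ0 (1 - b)
  refine ⟨LinearMap.toMatrix' N, c, LinearMap.toMatrix' R, ?_, fun x hx => ?_⟩
  · intro u v huv
    simp only [LinearMap.toMatrix'_mulVec] at huv
    exact hN huv
  · simp only [LinearMap.toMatrix'_mulVec]
    have hmem : x - c ∈ LinearMap.ker φ := by
      rw [LinearMap.mem_ker, map_sub, hc, hφ, ← hx]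
      ring
    obtain ⟨u, hu⟩ : ∃ u, N u = x - c := ⟨ε.symm ⟨x - c, hmem⟩, by simp [N]⟩
    have hRu : R (N u) = u := LinearMap.congr_fun hR u
    rw [← hu, hRu, hu, sub_add_cancel]

/-- If `g` has low degree on the hyperplane `L ⬝ᵥ x + b = 1`, then so does its product with
the indicator of this hyperplane. -/
theorem degLE_mul_of_hyperplane {k d : ℕ} {g : (Fin (k + 1) → ZMod 2) → ZMod 2}
    {L : Fin (k + 1) → ZMod 2} {b : ZMod 2} {N : Matrix (Fin (k + 1)) (Fin k) (ZMod 2)}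
    {c : Fin (k + 1) → ZMod 2} {R : Matrix (Fin k) (Fin (k + 1)) (ZMod 2)}
    (h : ∀ x, L ⬝ᵥ x + b = 1 → N.mulVec (R.mulVec (x - c)) + c = x)
    (hg : degLE k d fun u => g (N.mulVec u + c)) :
    degLE (k + 1) (d + 1) fun x => g x * (L ⬝ᵥ x + b) := by
  have h1 := hg.comp (fun x => R.mulVec (x - c)) fun i => by
    have := degLE_linear (R i) (-(R i ⬝ᵥ c))
    simpa [Matrix.mulVec, dotProduct_sub, sub_eq_add_neg] using this
  convert h1.mul (degLE_linear L b) using 2 with x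
  have h01 : ∀ a : ZMod 2, a = 0 ∨ a = 1 := by decide
  rcases h01 (L ⬝ᵥ x + b) with hx | hx
  · rw [hx, mul_zero, mul_zero]
  · rw [h x hx]

/-- At least half of all hyperplanes witness that `g` does not have degree at most `d`. -/
theorem card_hyperplanes_le {k d : ℕ} (hd : d + 1 ≤ k) {g : (Fin (k + 1) → ZMod 2) → ZMod 2}
    (hg : ¬ degLE (k + 1) d g)
    (P : (Fin (k + 1) → ZMod 2) × ZMod 2 → Prop)
    (hP : ∀ ℓ, ℓ.1 ≠ 0 → P ℓ → degLE (k + 1) (d + 1) fun x => g x * (ℓ.1 ⬝ᵥ x + ℓ.2)) :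
    (Finset.univ.filter fun ℓ : (Fin (k + 1) → ZMod 2) × ZMod 2 => ℓ.1 ≠ 0).card ≤
      2 * ((Finset.univ.filter fun ℓ : (Fin (k + 1) → ZMod 2) × ZMod 2 => ℓ.1 ≠ 0).filter
        fun ℓ => ¬ P ℓ).card := by
  set I := Finset.univ.filter fun ℓ : (Fin (k + 1) → ZMod 2) × ZMod 2 => ℓ.1 ≠ 0 with hI
  let D : (Fin (k + 1) → ZMod 2) × ZMod 2 → Prop := fun ℓ =>
    degLE (k + 1) (d + 1) fun x => g x * (ℓ.1 ⬝ᵥ x + ℓ.2)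
  have hadd : ∀ ℓ ℓ', D ℓ → D ℓ' → D (ℓ + ℓ') := by
    intro ℓ ℓ' h h'
    convert h.add h' using 2 with x
    simp only [Prod.fst_add, Prod.snd_add, add_dotProduct]
    ring
  obtain ⟨v, hv⟩ : ∃ v, ¬ D v := by
    by_contra! hall
    exact hg (degLE_of_mul_affine (by omega) fun L b => hall (L, b))
  have hself : ∀ ℓ : (Fin (k + 1) → ZMod 2) × ZMod 2, ℓ + ℓ = 0 := fun ℓ =>
    Prod.ext (funext fun i => CharTwo.add_self_eq_zero _) (CharTwo.add_self_eq_zero _)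
  have hhalf : (Finset.univ.filter D).card ≤ (Finset.univ.filter fun ℓ => ¬ D ℓ).card := by
    refine Finset.card_le_card_of_injOn (· + v) ?_ fun a _ b _ hab => add_right_cancel hab
    intro ℓ hℓ
    simp only [Finset.coe_filter, Finset.mem_univ, true_and, Set.mem_ofPred_eq] at hℓ ⊢
    intro h
    have := hadd _ _ hℓ h
    rw [← add_assoc, hself, zero_add] at this
    exact hv this
  have htot := Finset.card_filter_add_card_filter_not (s := Finset.univ) D
  have hItot : I.card + (Finset.univ.filter
      fun ℓ : (Fin (k + 1) → ZMod 2) × ZMod 2 => ¬ ℓ.1 ≠ 0).card =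
      (Finset.univ : Finset ((Fin (k + 1) → ZMod 2) × ZMod 2)).card := by
    convert Finset.card_filter_add_card_filter_not _
  have hconst : (Finset.univ.filter
      fun ℓ : (Fin (k + 1) → ZMod 2) × ZMod 2 => ¬ ℓ.1 ≠ 0).card ≤ 2 := by
    refine (Finset.card_le_card_of_injOn Prod.snd (t := Finset.univ)
      (fun _ _ => Finset.mem_coe.2 (Finset.mem_univ _)) ?_).trans (by simp)
    intro a ha b hb hab
    simp only [Finset.coe_filter, Finset.mem_univ, true_and, Set.mem_ofPred_eq, not_not] at ha hb
    exact Prod.ext (ha.trans hb.symm) hab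
  have hacc : (I.filter P).card < (Finset.univ.filter D).card := by
    refine Finset.card_lt_card ⟨fun ℓ hℓ => ?_, fun hsub => ?_⟩
    · simp only [hI, Finset.mem_filter, Finset.mem_univ, true_and] at hℓ ⊢
      exact hP ℓ hℓ.1 hℓ.2
    · have h0 : D 0 := by simpa [D] using degLE_const (n := k + 1) (d := d + 1) 0
      have := hsub (Finset.mem_filter.2 ⟨Finset.mem_univ 0, h0⟩)
      simp [hI] at this
  have hIsplit := Finset.card_filter_add_card_filter_not (s := I) P
  omega

/-- The general linear group acts transitively on injective matrices. -/
theorem exists_mul_eq_of_injective {n k : ℕ} {A A' : Matrix (Fin n) (Fin k) (ZMod 2)}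
    (hA : Function.Injective A.mulVec) (hA' : Function.Injective A'.mulVec) :
    ∃ G H : Matrix (Fin n) (Fin n) (ZMod 2), H * G = 1 ∧ G * A = A' := by
  let e := LinearEquiv.ofInjective A.mulVecLin hA
  let e' := LinearEquiv.ofInjective A'.mulVecLin hA'
  obtain ⟨g, hg⟩ := Submodule.exists_linearEquiv_restrict_eq (e.symm ≪≫ₗ e')
  refine ⟨LinearMap.toMatrix' g.toLinearMap, LinearMap.toMatrix' g.symm.toLinearMap, ?_, ?_⟩
  · rw [← LinearMap.toMatrix'_comp]
    simp
  · apply Matrix.ext_of_mulVec_single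
    intro i
    rw [← Matrix.mulVec_mulVec, LinearMap.toMatrix'_mulVec]
    have := hg (e (Pi.single i 1))
    simp only [LinearEquiv.trans_apply, LinearEquiv.symm_apply_apply] at this
    exact this.symm

theorem card_filter_comp_mul_card {α β : Type*} (s : Finset α) (t : Finset β) (φ : α → β)
    (hφ : ∀ a ∈ s, φ a ∈ t)
    (hfib : ∀ y ∈ t, ∀ y' ∈ t, (s.filter fun a => φ a = y).card ≤ (s.filter fun a => φ a = y').card)
    (P : β → Prop) :
    (s.filter fun a => P (φ a)).card * t.card = (t.filter P).card * s.card := by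
  rcases t.eq_empty_or_nonempty with rfl | ⟨y₀, hy₀⟩
  · simp
  have hc : ∀ y ∈ t, (s.filter fun a => φ a = y).card = (s.filter fun a => φ a = y₀).card :=
    fun y hy => le_antisymm (hfib y hy y₀ hy₀) (hfib y₀ hy₀ y hy)
  have hs : s.card = t.card * (s.filter fun a => φ a = y₀).card := by
    rw [Finset.card_eq_sum_card_fiberwise (f := φ) (t := t) hφ, Finset.sum_congr rfl hc]
    simp
  have hsP : (s.filter fun a => P (φ a)).card =
      (t.filter P).card * (s.filter fun a => φ a = y₀).card := by
    rw [Finset.card_eq_sum_card_fiberwise (f := φ) (t := t.filter P), ← smul_eq_mul,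
      ← Finset.sum_const]
    · refine Finset.sum_congr rfl fun y hy => ?_
      rw [Finset.mem_filter] at hy
      rw [← hc y hy.1, Finset.filter_filter]
      congr 1
      refine Finset.filter_congr fun a _ => ⟨fun h => h.2, fun h => ⟨h ▸ hy.2, h⟩⟩
    · intro a ha
      simp only [Finset.coe_filter, Set.mem_ofPred_eq] at ha ⊢
      exact ⟨hφ a ha.1, ha.2⟩
  rw [hs, hsP]
  ring

/-- The injective affine maps `u ↦ M u + b` from `𝔽₂ᵏ` to `𝔽₂ⁿ`. -/
def injAffine (n k : ℕ) : Finset (Matrix (Fin n) (Fin k) (ZMod 2) × (Fin n → ZMod 2)) :=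
  Finset.univ.filter fun Mb => Function.Injective Mb.1.mulVec

/-- Precomposition of the affine map `u ↦ M u + b` with `u ↦ N u + c`. -/
def affineComp {n k j : ℕ} (N : Matrix (Fin k) (Fin j) (ZMod 2)) (c : Fin k → ZMod 2)
    (Mb : Matrix (Fin n) (Fin k) (ZMod 2) × (Fin n → ZMod 2)) :
    Matrix (Fin n) (Fin j) (ZMod 2) × (Fin n → ZMod 2) :=
  (Mb.1 * N, Mb.1.mulVec c + Mb.2)

theorem affineComp_mem {n k j : ℕ} {N : Matrix (Fin k) (Fin j) (ZMod 2)}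
    (hN : Function.Injective N.mulVec) (c : Fin k → ZMod 2)
    {Mb : Matrix (Fin n) (Fin k) (ZMod 2) × (Fin n → ZMod 2)} (h : Mb ∈ injAffine n k) :
    affineComp N c Mb ∈ injAffine n j := by
  simp only [injAffine, Finset.mem_filter, Finset.mem_univ, true_and, affineComp] at h ⊢
  intro u v huv
  simp only [← Matrix.mulVec_mulVec] at huv
  exact hN (h huv)

/-- Precomposing a uniformly random injective affine map with a fixed one gives a uniformly
random injective affine map. -/
theorem card_filter_affineComp {n k j : ℕ} {N : Matrix (Fin k) (Fin j) (ZMod 2)}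
    (hN : Function.Injective N.mulVec) (c : Fin k → ZMod 2)
    (P : Matrix (Fin n) (Fin j) (ZMod 2) × (Fin n → ZMod 2) → Prop) :
    ((injAffine n k).filter fun Mb => P (affineComp N c Mb)).card * (injAffine n j).card =
      ((injAffine n j).filter P).card * (injAffine n k).card := by
  refine card_filter_comp_mul_card _ _ _ (fun _ => affineComp_mem hN c) ?_ P
  rintro ⟨A, u⟩ hA ⟨A', u'⟩ hA'
  simp only [injAffine, Finset.mem_filter, Finset.mem_univ, true_and] at hA hA'
  obtain ⟨G, H, hHG, hGA⟩ := exists_mul_eq_of_injective hA hA'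
  have hG : Function.Injective G.mulVec := by
    intro x y hxy
    have := congrArg H.mulVec hxy
    simpa [Matrix.mulVec_mulVec, hHG] using this
  refine Finset.card_le_card_of_injOn
    (fun Mb => (G * Mb.1, u' - (G * Mb.1).mulVec c)) ?_ ?_
  · rintro ⟨M, b⟩ hMb
    simp only [injAffine, affineComp, Finset.coe_filter, Finset.mem_filter, Finset.mem_univ,
      true_and, Set.mem_ofPred_eq, Prod.mk.injEq] at hMb ⊢
    obtain ⟨hM, hMA, -⟩ := hMb
    refine ⟨fun x y hxy => ?_, by rw [Matrix.mul_assoc, hMA, hGA], by abel⟩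
    simp only [← Matrix.mulVec_mulVec] at hxy
    exact hM (hG hxy)
  · rintro ⟨M, b⟩ hMb ⟨M', b'⟩ hMb' heq
    simp only [injAffine, affineComp, Finset.coe_filter, Finset.mem_filter, Finset.mem_univ,
      true_and, Set.mem_ofPred_eq, Prod.mk.injEq] at hMb hMb' heq
    have hMM : M = M' := by
      have := congrArg (H * ·) heq.1
      simpa [← Matrix.mul_assoc, hHG] using this
    subst hMM
    exact Prod.ext rfl (add_left_cancel (hMb.2.2.trans hMb'.2.2.symm))

theorem Rej_eq (n d k : ℕ) (f : (Fin n → ZMod 2) → ZMod 2) :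
    Rej n d k f = (((injAffine n k).filter fun Mb =>
      ¬ degLE k d fun u => f (Mb.1.mulVec u + Mb.2)).card : ℝ) / (injAffine n k).card := by
  rw [Rej, injAffine, Finset.filter_filter]

theorem Rej_succ_le (n d k : ℕ) (hd : d + 1 ≤ k) (f : (Fin n → ZMod 2) → ZMod 2) :
    Rej n d (k + 1) f ≤ 2 * Rej n d k f := by
  set I := Finset.univ.filter fun ℓ : (Fin (k + 1) → ZMod 2) × ZMod 2 => ℓ.1 ≠ 0 with hI
  have hparam : ∀ ℓ : (Fin (k + 1) → ZMod 2) × ZMod 2, ∃ (N : Matrix (Fin (k + 1)) (Fin k) (ZMod 2))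
      (c : Fin (k + 1) → ZMod 2) (R : Matrix (Fin k) (Fin (k + 1)) (ZMod 2)), ℓ.1 ≠ 0 →
      Function.Injective N.mulVec ∧
      ∀ x, ℓ.1 ⬝ᵥ x + ℓ.2 = 1 → N.mulVec (R.mulVec (x - c)) + c = x := by
    intro ℓ
    by_cases hℓ : ℓ.1 = 0
    · exact ⟨0, 0, 0, fun h => absurd hℓ h⟩
    · obtain ⟨N, c, R, h⟩ := exists_hyperplane_param hℓ ℓ.2
      exact ⟨N, c, R, fun _ => h⟩
  choose N c R hNR using hparam
  have hIpos : 0 < I.card :=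
    Finset.card_pos.2 ⟨(fun _ => 1, 0), by simpa [hI] using fun h => one_ne_zero (congrFun h 0)⟩
  let rej (j : ℕ) (Mb : Matrix (Fin n) (Fin j) (ZMod 2) × (Fin n → ZMod 2)) : Prop :=
    ¬ degLE j d fun u => f (Mb.1.mulVec u + Mb.2)
  have hsum : (∑ ℓ ∈ I, ((injAffine n (k + 1)).filter
      fun Mb => rej k (affineComp (N ℓ) (c ℓ) Mb)).card) * (injAffine n k).card =
      I.card * (((injAffine n k).filter (rej k)).card * (injAffine n (k + 1)).card) := by
    rw [Finset.sum_mul, ← smul_eq_mul (a := I.card), ← Finset.sum_const]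
    refine Finset.sum_congr rfl fun ℓ hℓ => ?_
    convert card_filter_affineComp (hNR ℓ (Finset.mem_filter.1 hℓ).2).1 (c ℓ) (rej k)
  have hswap : ∑ ℓ ∈ I, ((injAffine n (k + 1)).filter
      fun Mb => rej k (affineComp (N ℓ) (c ℓ) Mb)).card =
      ∑ Mb ∈ injAffine n (k + 1), (I.filter
        fun ℓ => rej k (affineComp (N ℓ) (c ℓ) Mb)).card :=
    Finset.sum_card_bipartiteAbove_eq_sum_card_bipartiteBelow
      (r := fun ℓ Mb => rej k (affineComp (N ℓ) (c ℓ) Mb))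
  have hlow : ((injAffine n (k + 1)).filter (rej (k + 1))).card * I.card ≤
      2 * ∑ Mb ∈ injAffine n (k + 1), (I.filter
        fun ℓ => rej k (affineComp (N ℓ) (c ℓ) Mb)).card := by
    rw [← smul_eq_mul, ← Finset.sum_const, Finset.mul_sum]
    refine (Finset.sum_le_sum fun Mb hMb => ?_).trans
      (Finset.sum_le_sum_of_subset (Finset.filter_subset (rej (k + 1)) _))
    refine card_hyperplanes_le hd (Finset.mem_filter.1 hMb).2
      (fun ℓ => degLE k d fun u =>
        f ((affineComp (N ℓ) (c ℓ) Mb).1.mulVec u + (affineComp (N ℓ) (c ℓ) Mb).2)) ?_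
    intro ℓ hℓ hdeg
    refine degLE_mul_of_hyperplane (hNR ℓ hℓ).2 ?_
    simpa [affineComp, Matrix.mulVec_add, ← Matrix.mulVec_mulVec, add_assoc] using hdeg
  have hmain : ((injAffine n (k + 1)).filter (rej (k + 1))).card * (injAffine n k).card ≤
      2 * (((injAffine n k).filter (rej k)).card * (injAffine n (k + 1)).card) := by
    refine Nat.le_of_mul_le_mul_left ?_ hIpos
    calc _ = ((injAffine n (k + 1)).filter (rej (k + 1))).card * I.card *
          (injAffine n k).card := by ring
      _ ≤ _ := Nat.mul_le_mul_right _ hlow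
      _ = _ := by rw [← hswap, mul_assoc, hsum]; ring
  rw [Rej_eq, Rej_eq]
  rcases (injAffine n (k + 1)).eq_empty_or_nonempty with h0 | ⟨Mb, hMb⟩
  · rw [h0]
    simp only [Finset.card_empty, Nat.cast_zero, div_zero]
    positivity
  obtain ⟨ℓ, hℓ⟩ := Finset.card_pos.1 hIpos
  have hX : (0 : ℝ) < (injAffine n (k + 1)).card := by
    exact_mod_cast Finset.card_pos.2 ⟨Mb, hMb⟩
  have hY : (0 : ℝ) < (injAffine n k).card := by
    exact_mod_cast Finset.card_pos.2
      ⟨_, affineComp_mem (hNR ℓ (Finset.mem_filter.1 hℓ).2).1 (c ℓ) hMb⟩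
  rw [← mul_div_assoc, div_le_div_iff₀ hX hY, mul_assoc]
  exact_mod_cast hmain

end Flats

theorem statement5 (n d k k' : ℕ) (h1 : d + 1 ≤ k') (h2 : k' ≤ k) (h3 : k ≤ n)
    (f : (Fin n → ZMod 2) → ZMod 2) :
    Rej n d k f * (2:ℝ) ^ ((k':ℤ) - k) ≤ Rej n d k' f := by
  clear h3
  induction k, h2 using Nat.le_induction with
  | base => simp
  | succ k hk ih =>
    refine le_trans ?_ ih
    have hpow : (2 : ℝ) ^ ((k' : ℤ) - k) = 2 * 2 ^ ((k' : ℤ) - (k + 1 : ℕ)) := by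
      rw [← zpow_one_add₀ two_ne_zero]
      congr 1
      push_cast
      ring
    rw [hpow, ← mul_assoc, mul_comm (Rej n d k f)]
    exact mul_le_mul_of_nonneg_right (Rej_succ_le n d k (h1.trans hk) f) (by positivity)

end
end
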